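/- For the partially observable control model, suppose the one-stage cost c is real-valued and bounded above or below on 𝕏 × 𝔸 (and lower semianalytic), and let J be any of the average cost criteria J^(1)–J^(4), J̃^(1)–J̃^(4) or the risk criteria J_ψ, Ĵ_ψ, CVaR R₁, VaR R₂, defined on pairs (π, p_0) of policies and initial distributions. Then with respect to J and Π_⋆ ∈ {Π_I, Π'_I}: (i) the optimal value function g(p_0) = inf over π ∈ Π_⋆ of J(π, p_0) is lower semianalytic on P(𝕏); and (ii) for each ε > 0 there exists an ε-optimal policy π* ∈ Π_⋆ that is moreover optimal for every initial distribution admitting an optimal policy. -/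

import Mathlib

open MeasureTheory ProbabilityTheory Filter
open scoped ENNReal NNReal Topology

noncomputable section

namespace PaperStmt

/-- The Borel σ-algebra of the topology of weak convergence on the space of Borel
probability measures. -/
instance instMeasProb {Ω : Type*} [MeasurableSpace Ω] [TopologicalSpace Ω]
    [OpensMeasurableSpace Ω] : MeasurableSpace (ProbabilityMeasure Ω) := borel _

/-- A set is universally measurable if it is measurable with respect to the completion of
every Borel probability measure. -/
def UniversallyMeasurableSet {α : Type*} [MeasurableSpace α] (s : Set α) : Prop :=
  ∀ μ : Measure α, IsProbabilityMeasure μ → NullMeasurableSet s μ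

/-- A map between measurable spaces is universally measurable if preimages of measurable
sets are universally measurable. -/
def UniversallyMeasurable {α β : Type*} [MeasurableSpace α] [MeasurableSpace β]
    (f : α → β) : Prop :=
  ∀ s : Set β, MeasurableSet s → UniversallyMeasurableSet (f ⁻¹' s)

/-- A function into the extended reals is lower semianalytic if all its sublevel sets are
analytic. -/
def LowerSemianalytic {γ : Type*} [TopologicalSpace γ] (f : γ → EReal) : Prop :=
  ∀ r : ℝ, MeasureTheory.AnalyticSet {x | f x ≤ (r : EReal)}

/-- The nonnegative part of an extended real number, as an element of `ℝ≥0∞`. -/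
def ePos (y : EReal) : ℝ≥0∞ := if y = ⊤ then ⊤ else ENNReal.ofReal y.toReal

/-- The integral `∫ f⁺ dμ - ∫ f⁻ dμ` of an extended-real-valued function, with the
convention `∞ - ∞ = ∞`. -/
def eint {γ : Type*} [MeasurableSpace γ] (μ : Measure γ) (f : γ → EReal) : EReal :=
  if (∫⁻ x, ePos (f x) ∂μ) = ⊤ then ⊤
  else ((∫⁻ x, ePos (f x) ∂μ : ℝ≥0∞) : EReal) - ((∫⁻ x, ePos (-f x) ∂μ : ℝ≥0∞) : EReal)

/-- Finite sums of extended reals, with the convention `∞ - ∞ = ∞`. -/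
def esum {n : ℕ} (v : Fin n → EReal) : EReal :=
  if (∑ i, ePos (v i)) = ⊤ then ⊤
  else ((∑ i, ePos (v i) : ℝ≥0∞) : EReal) - ((∑ i, ePos (-v i) : ℝ≥0∞) : EReal)

/-- The space `I_n = (ℤ × 𝔸)ⁿ × ℤ` of information vectors `i_n = (z_0,a_0,…,z_n)`. -/
abbrev Info (Z A : Type*) (n : ℕ) := (Fin n → Z × A) × Z

/-- The sample space `Ω = (𝕏 × ℤ × 𝔸)^∞` of the partially observable model. -/
abbrev TrajO (X Z A : Type*) := ℕ → X × Z × A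

/-- Histories `(x_0, z_0, a_0, …, x_n)` of the partially observable model. -/
abbrev HistO (X Z A : Type*) (n : ℕ) := (Fin n → X × Z × A) × X

/-- The information vector determined by a history, for the observation function `F`. -/
def infoOf {X Z A : Type*} (F : X → Z) : ∀ {n : ℕ}, HistO X Z A n → Info Z A n :=
  fun {_} h => (fun k => (h.1 k).2, F h.2)

/-- A universally measurable policy for the partially observable model: a sequence of
universally measurable stochastic kernels on `𝔸` given `I_n × P(𝕏)` respecting the
control constraints `U n`. -/
structure PolicyI (X : Type*) {Z A : Type*} [MeasurableSpace X] [TopologicalSpace X]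
    [OpensMeasurableSpace X] [MeasurableSpace Z] [MeasurableSpace A]
    (U : ∀ n : ℕ, Info Z A n → Set A) where
  μ : ∀ n : ℕ, Info Z A n × ProbabilityMeasure X → Measure A
  isProb : ∀ n ip, IsProbabilityMeasure (μ n ip)
  umeas : ∀ (n : ℕ) (B : Set A), MeasurableSet B →
    UniversallyMeasurable fun ip : Info Z A n × ProbabilityMeasure X => μ n ip B
  feasible : ∀ n i p0, μ n (i, p0) (U n i) = 1

/-- Nonrandomized policies of the partially observable model. -/
def PolicyI.Nonrandomized {X Z A : Type*} [MeasurableSpace X] [TopologicalSpace X]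
    [OpensMeasurableSpace X] [MeasurableSpace Z] [MeasurableSpace A]
    {U : ∀ n : ℕ, Info Z A n → Set A} (π : PolicyI X U) : Prop :=
  ∀ n ip, ∃ a : A, π.μ n ip = Measure.dirac a

variable {X Z A : Type*} [MeasurableSpace X] [TopologicalSpace X] [OpensMeasurableSpace X]
  [MeasurableSpace Z] [MeasurableSpace A]

/-- The iterated integral giving the finite-dimensional distributions of the partially
observable control model. -/
def histIntO (p0 : Measure X) (F : X → Z) (q : Kernel (X × A) X)
    (ν : ∀ n : ℕ, Info Z A n → Measure A) :
    ∀ n : ℕ, (HistO X Z A n → ℝ≥0∞) → ℝ≥0∞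
  | 0, g => ∫⁻ x, g (Fin.elim0, x) ∂p0
  | n + 1, g => histIntO p0 F q ν n fun h =>
      ∫⁻ a, ∫⁻ y, g (Fin.snoc h.1 (h.2, F h.2, a), y) ∂(q (h.2, a)) ∂(ν n (infoOf F h))

/-- `InducesI q F π p0 p` says that `p` is the strategic measure `ρ_{p0}[π]` of the
partially observable model with transition kernel `q` and observation function `F`. -/
def InducesI (q : Kernel (X × A) X) (F : X → Z) {U : ∀ n : ℕ, Info Z A n → Set A}
    (π : PolicyI X U) (p0 : ProbabilityMeasure X) (p : Measure (TrajO X Z A)) : Prop :=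
  ∀ (n : ℕ) (B : Set (HistO X Z A n)), MeasurableSet B →
    p {ω : TrajO X Z A | ((fun i : Fin n => ω i.val), (ω n).1) ∈ B}
      = histIntO p0.toMeasure F q (fun n i => π.μ n (i, p0)) n (B.indicator fun _ => 1)

/-- The set of strategic measures of the partially observable model induced by policies in
the class `C`. -/
def SIOf (q : Kernel (X × A) X) (F : X → Z) (U : ∀ n : ℕ, Info Z A n → Set A)
    (C : PolicyI X U → Prop) : Set (ProbabilityMeasure (TrajO X Z A)) :=
  {p | ∃ (π : PolicyI X U) (p0 : ProbabilityMeasure X), C π ∧ InducesI q F π p0 p.toMeasure}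

/-- The section `tilde-S_I(p0)`. -/
def tsecI (q : Kernel (X × A) X) (F : X → Z) (U : ∀ n : ℕ, Info Z A n → Set A)
    (C : PolicyI X U → Prop) (p0 : ProbabilityMeasure X) :
    Set (ProbabilityMeasure (TrajO X Z A)) :=
  {p | p ∈ SIOf q F U C ∧ p.toMeasure.map (fun ω => (ω 0).1) = p0.toMeasure}

/-- The set `tilde-S_I ⊂ P(𝕏) × P(Ω)`. -/
def tsetI (q : Kernel (X × A) X) (F : X → Z) (U : ∀ n : ℕ, Info Z A n → Set A)
    (C : PolicyI X U → Prop) :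
    Set (ProbabilityMeasure X × ProbabilityMeasure (TrajO X Z A)) :=
  {pp | pp.2 ∈ tsecI q F U C pp.1}

end PaperStmt

namespace PaperStmt

variable {X Z A : Type*} [MeasurableSpace X] [TopologicalSpace X] [OpensMeasurableSpace X]
  [MeasurableSpace Z] [MeasurableSpace A]

/-- The partial sum `Σ_{k=0}^{n-1} c(x_{k+j}, a_{k+j})` along a sample path of the
partially observable model, with the convention `∞ - ∞ = ∞`. -/
def pathSumO (c : X × A → EReal) (n j : ℕ) (ω : TrajO X Z A) : EReal :=
  esum fun k : Fin n => c ((ω (k.val + j)).1, (ω (k.val + j)).2.2)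

/-- Division by `n` in the extended reals. -/
def avg (n : ℕ) (y : EReal) : EReal := (((n : ℝ)⁻¹ : ℝ) : EReal) * y

/-- `J^(1)`. -/
def J1O (c : X × A → EReal) (p : ProbabilityMeasure (TrajO X Z A)) : EReal :=
  limsup (fun n : ℕ => avg n (eint p.toMeasure (pathSumO c n 0))) atTop

/-- `J^(2)`. -/
def J2O (c : X × A → EReal) (p : ProbabilityMeasure (TrajO X Z A)) : EReal :=
  liminf (fun n : ℕ => avg n (eint p.toMeasure (pathSumO c n 0))) atTop

/-- `J^(3)`. -/
def J3O (c : X × A → EReal) (p : ProbabilityMeasure (TrajO X Z A)) : EReal :=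
  limsup (fun n : ℕ => ⨆ j : ℕ, avg n (eint p.toMeasure (pathSumO c n j))) atTop

/-- `J^(4)`. -/
def J4O (c : X × A → EReal) (p : ProbabilityMeasure (TrajO X Z A)) : EReal :=
  liminf (fun n : ℕ => ⨅ j : ℕ, avg n (eint p.toMeasure (pathSumO c n j))) atTop

/-- `J̃^(1)`. -/
def Jt1O (c : X × A → EReal) (p : ProbabilityMeasure (TrajO X Z A)) : EReal :=
  eint p.toMeasure fun ω => limsup (fun n : ℕ => avg n (pathSumO c n 0 ω)) atTop

/-- `J̃^(2)`. -/
def Jt2O (c : X × A → EReal) (p : ProbabilityMeasure (TrajO X Z A)) : EReal :=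
  eint p.toMeasure fun ω => liminf (fun n : ℕ => avg n (pathSumO c n 0 ω)) atTop

/-- `J̃^(3)`. -/
def Jt3O (c : X × A → EReal) (p : ProbabilityMeasure (TrajO X Z A)) : EReal :=
  eint p.toMeasure fun ω => limsup (fun n : ℕ => ⨆ j : ℕ, avg n (pathSumO c n j ω)) atTop

/-- `J̃^(4)`. -/
def Jt4O (c : X × A → EReal) (p : ProbabilityMeasure (TrajO X Z A)) : EReal :=
  eint p.toMeasure fun ω => liminf (fun n : ℕ => ⨅ j : ℕ, avg n (pathSumO c n j ω)) atTop

/-- The risk functional `J_ψ`. -/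
def JpsiO (c : X × A → EReal) (ψ : EReal → ℝ≥0∞) (ψinv : ℝ≥0∞ → EReal)
    (p : ProbabilityMeasure (TrajO X Z A)) : EReal :=
  limsup (fun n : ℕ => avg n (ψinv (∫⁻ ω, ψ (pathSumO c n 0 ω) ∂p.toMeasure))) atTop

/-- The risk functional `Ĵ_ψ`. -/
def JpsiHatO (c : X × A → EReal) (ψ : EReal → ℝ≥0∞) (ψinv : ℝ≥0∞ → EReal)
    (p : ProbabilityMeasure (TrajO X Z A)) : EReal :=
  limsup (fun n : ℕ => ⨆ j : ℕ,
    avg n (ψinv (∫⁻ ω, ψ (pathSumO c n j ω) ∂p.toMeasure))) atTop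

/-- The pathwise average cost `c̄(ω)`. -/
def cbarO (c : X × A → EReal) (ω : TrajO X Z A) : EReal :=
  limsup (fun n : ℕ => avg n (pathSumO c n 0 ω)) atTop

/-- The `CVaR_α` functional of the pathwise average cost. -/
def RcvarO (c : X × A → EReal) (α : ℝ) (p : ProbabilityMeasure (TrajO X Z A)) : EReal :=
  ⨅ z : ℝ, ((z : EReal) +
    (((ENNReal.ofReal α)⁻¹ * ∫⁻ ω, ePos (cbarO c ω - (z : EReal)) ∂p.toMeasure : ℝ≥0∞) : EReal))

/-- The `VaR_α` functional of the pathwise average cost. -/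
def RvarO (c : X × A → EReal) (α : ℝ) (p : ProbabilityMeasure (TrajO X Z A)) : EReal :=
  ⨅ (z : ℝ) (_ : 1 - ENNReal.ofReal α ≤ p.toMeasure {ω | cbarO c ω ≤ (z : EReal)}), (z : EReal)

/-- The optimal value function `g(p0) = inf_{π ∈ Π_⋆} J(π, p0)` of the partially
observable problem, expressed through strategic measures. -/
def gOptI (q : Kernel (X × A) X) (F : X → Z) {U : ∀ n : ℕ, Info Z A n → Set A}
    (C : PolicyI X U → Prop) (J : ProbabilityMeasure (TrajO X Z A) → EReal)
    (p0 : ProbabilityMeasure X) : EReal :=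
  ⨅ (π : PolicyI X U) (_ : C π) (p : ProbabilityMeasure (TrajO X Z A))
    (_ : InducesI q F π p0 p.toMeasure), J p

/-- Existence of a policy in the class `C` that is `ε`-optimal w.r.t. `J` and `C` and
optimal at every initial distribution that admits an optimal policy in `C`. -/
def GoodPolicyI (q : Kernel (X × A) X) (F : X → Z) {U : ∀ n : ℕ, Info Z A n → Set A}
    (C : PolicyI X U → Prop) (J : ProbabilityMeasure (TrajO X Z A) → EReal) (ε : ℝ) : Prop :=
  ∃ (π : PolicyI X U) (R : ProbabilityMeasure X → ProbabilityMeasure (TrajO X Z A)),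
    C π ∧ (∀ p0, InducesI q F π p0 (R p0).toMeasure) ∧
    (∀ p0, (gOptI q F C J p0 ≠ ⊥ → J (R p0) ≤ gOptI q F C J p0 + (ε : EReal)) ∧
           (gOptI q F C J p0 = ⊥ → J (R p0) ≤ ((-ε⁻¹ : ℝ) : EReal))) ∧
    (∀ p0, (∃ (π' : PolicyI X U) (p : ProbabilityMeasure (TrajO X Z A)),
             C π' ∧ InducesI q F π' p0 p.toMeasure ∧ J p = gOptI q F C J p0) →
           J (R p0) = gOptI q F C J p0)

end PaperStmt

namespace PaperStmt

set_option linter.unusedSectionVars false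

/-! ### Analytic sets: closure properties and capacitability -/

section Analytic

variable {α β γ : Type*}

theorem _root_.MeasurableSet.analyticSet' [TopologicalSpace α] [SecondCountableTopology α]
    [MeasurableSpace α] [OpensMeasurableSpace α] [StandardBorelSpace α] {s : Set α}
    (hs : MeasurableSet s) : AnalyticSet s := by
  simpa using hs.analyticSet_image measurable_id

theorem _root_.MeasureTheory.AnalyticSet.inter [TopologicalSpace α] [T2Space α] {s t : Set α}
    (hs : AnalyticSet s) (ht : AnalyticSet t) : AnalyticSet (s ∩ t) := by
  rw [Set.inter_eq_iInter]
  exact AnalyticSet.iInter fun b => by cases b <;> assumption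

theorem _root_.MeasureTheory.AnalyticSet.union [TopologicalSpace α] {s t : Set α}
    (hs : AnalyticSet s) (ht : AnalyticSet t) : AnalyticSet (s ∪ t) := by
  rw [Set.union_eq_iUnion]
  exact AnalyticSet.iUnion fun b => by cases b <;> assumption

/-- The preimage of an analytic set under a Borel map is analytic. -/
theorem _root_.MeasureTheory.AnalyticSet.preimage_measurable [TopologicalSpace α]
    [SecondCountableTopology α] [MeasurableSpace α] [OpensMeasurableSpace α]
    [StandardBorelSpace α] [TopologicalSpace β] [MeasurableSpace β] [BorelSpace β]
    [T2Space β] [SecondCountableTopology β] {s : Set β} (hs : AnalyticSet s) {f : α → β}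
    (hf : Measurable f) : AnalyticSet (f ⁻¹' s) := by
  obtain ⟨W, _, _, g, hg, rfl⟩ := analyticSet_iff_exists_polishSpace_range.1 hs
  borelize W
  have h : MeasurableSet {x : α × W | f x.1 = g x.2} :=
    measurableSet_eq_fun (hf.comp measurable_fst) (hg.measurable.comp measurable_snd)
  convert! h.analyticSet_image measurable_fst using 1
  ext x
  simp [eq_comm]

/-- The set of sequences whose first `m` coordinates are dominated by those of `b`. -/
def dominatedUpTo (b : ℕ → ℕ) (m : ℕ) : Set (ℕ → ℕ) := {x | ∀ i < m, x i ≤ b i}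

theorem exists_dominatedUpTo_lt_measure [MeasurableSpace α] (μ : Measure α) (f : (ℕ → ℕ) → α)
    {s : ℝ≥0∞} (hs : s < μ (Set.range f)) :
    ∃ b : ℕ → ℕ, ∀ m, s < μ (f '' dominatedUpTo b m) := by
  have step : ∀ (T : Set (ℕ → ℕ)) (m : ℕ), s < μ (f '' T) →
      ∃ k : ℕ, s < μ (f '' (T ∩ {x | x m ≤ k})) := by
    intro T m hT
    have hmono : Monotone fun k : ℕ => f '' (T ∩ {x | x m ≤ k}) := fun k l hkl =>
      Set.image_mono fun x hx => ⟨hx.1, le_trans (show x m ≤ k from hx.2) hkl⟩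
    have hU : f '' T = ⋃ k : ℕ, f '' (T ∩ {x | x m ≤ k}) := by
      rw [← Set.image_iUnion, ← Set.inter_iUnion]
      congr 1
      ext x
      simp only [Set.mem_inter_iff, Set.mem_iUnion, Set.mem_ofPred_eq]
      exact ⟨fun h => ⟨h, x m, le_rfl⟩, fun h => h.1⟩
    rw [hU, hmono.measure_iUnion] at hT
    exact lt_iSup_iff.1 hT
  let K : Set (ℕ → ℕ) → ℕ → ℕ := fun T m =>
    Classical.epsilon fun k => s < μ (f '' (T ∩ {x | x m ≤ k}))
  let T : ℕ → Set (ℕ → ℕ) := fun m =>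
    Nat.rec Set.univ (fun m S => S ∩ {x | x m ≤ K S m}) m
  have hT : ∀ m, T m = dominatedUpTo (fun m => K (T m) m) m := by
    intro m
    induction m with
    | zero => ext x; simp [T, dominatedUpTo]
    | succ m ih =>
      have : T (m + 1) = T m ∩ {x | x m ≤ K (T m) m} := rfl
      rw [this]
      ext x
      have hx : x ∈ T m ↔ x ∈ dominatedUpTo (fun m => K (T m) m) m := by rw [← ih]
      simp only [Set.mem_inter_iff, hx, dominatedUpTo, Set.mem_ofPred_eq]
      constructor
      · rintro ⟨h1, h2⟩ i hi
        rcases Nat.lt_succ_iff_lt_or_eq.1 hi with h | rfl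
        · exact h1 i h
        · exact h2
      · exact fun h => ⟨fun i hi => h i (hi.trans (Nat.lt_succ_self m)), h m (Nat.lt_succ_self m)⟩
  refine ⟨fun m => K (T m) m, fun m => ?_⟩
  rw [← hT]
  induction m with
  | zero => simpa [T, Set.image_univ] using hs
  | succ m ih => exact Classical.epsilon_spec (step (T m) m ih)

theorem isCompact_dominated (b : ℕ → ℕ) : IsCompact {x : ℕ → ℕ | ∀ i, x i ≤ b i} := by
  have h := isCompact_univ_pi fun i => (Set.finite_Iic (b i)).isCompact
  convert h using 1
  ext x
  simp [Pi.le_def]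

theorem exists_dominatedUpTo_subset (b : ℕ → ℕ) {V : Set (ℕ → ℕ)} (hV : IsOpen V)
    (hbV : {x : ℕ → ℕ | ∀ i, x i ≤ b i} ⊆ V) : ∃ m, dominatedUpTo b m ⊆ V := by
  by_contra! hcon
  simp only [Set.not_subset] at hcon
  choose x hx hxV using hcon
  obtain ⟨y, hy, φ, hφ, hlim⟩ := (isCompact_dominated b).tendsto_subseq
    (x := fun m i => min (x m i) (b i)) (fun m i => min_le_right _ _)
  have hlim' : Tendsto (x ∘ φ) atTop (𝓝 y) := by
    rw [tendsto_pi_nhds] at hlim ⊢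
    intro i
    refine (hlim i).congr' ?_
    filter_upwards [eventually_gt_atTop i] with k hk
    exact min_eq_left (hx (φ k) i (hk.trans_le (hφ.id_le k)))
  obtain ⟨k, hk⟩ := (hlim'.eventually (hV.mem_nhds (hbV hy))).exists
  exact hxV _ hk

theorem iInter_closure_image_dominatedUpTo_subset [TopologicalSpace α] [T2Space α]
    {f : (ℕ → ℕ) → α} (hf : Continuous f) (b : ℕ → ℕ) :
    ⋂ m, closure (f '' dominatedUpTo b m) ⊆ f '' {x | ∀ i, x i ≤ b i} := by
  intro y hy
  by_contra hyK
  obtain ⟨V, W, hV, hW, hKV, hyW, hVW⟩ :=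
    (((isCompact_dominated b).image hf).separation_of_notMem hyK)
  obtain ⟨m, hm⟩ := exists_dominatedUpTo_subset b (hV.preimage hf)
    (fun x hx => hKV (Set.mem_image_of_mem f hx))
  have hmem := Set.mem_iInter.1 hy m
  rw [mem_closure_iff] at hmem
  obtain ⟨z, hzW, x, hx, rfl⟩ := hmem W hW hyW
  exact Set.disjoint_left.1 hVW (hm hx) hzW

theorem le_measure_image_dominated [TopologicalSpace α] [T2Space α] [MeasurableSpace α]
    [OpensMeasurableSpace α] (μ : Measure α) [IsFiniteMeasure μ]
    {f : (ℕ → ℕ) → α} (hf : Continuous f) {b : ℕ → ℕ} {s : ℝ≥0∞}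
    (h : ∀ m, s ≤ μ (closure (f '' dominatedUpTo b m))) :
    s ≤ μ (f '' {x | ∀ i, x i ≤ b i}) := by
  refine le_trans ?_ (measure_mono (iInter_closure_image_dominatedUpTo_subset hf b))
  rw [Antitone.measure_iInter]
  · exact le_iInf h
  · intro k l hkl
    exact closure_mono (Set.image_mono fun x hx i hi => hx i (hi.trans_le hkl))
  · exact fun m => isClosed_closure.nullMeasurableSet
  · exact ⟨0, measure_ne_top _ _⟩

/-- Analytic sets are universally measurable. -/
theorem _root_.MeasureTheory.AnalyticSet.nullMeasurableSet [TopologicalSpace α] [T2Space α]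
    [MeasurableSpace α] [OpensMeasurableSpace α] {S : Set α} (hS : AnalyticSet S)
    (μ : Measure α) [IsFiniteMeasure μ] : NullMeasurableSet S μ := by
  rw [AnalyticSet] at hS
  rcases hS with rfl | ⟨f, hf, rfl⟩
  · exact nullMeasurableSet_empty
  set S := Set.range f with hSdef
  rcases eq_or_ne (μ S) 0 with h0 | h0
  · exact NullMeasurableSet.of_null h0
  obtain ⟨u, -, hu_lt, hu_lim⟩ := exists_seq_strictMono_tendsto' (pos_iff_ne_zero.2 h0)
  have hK : ∀ n, ∃ K : Set α, IsCompact K ∧ K ⊆ S ∧ u n ≤ μ K := by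
    intro n
    obtain ⟨b, hb⟩ := exists_dominatedUpTo_lt_measure μ f (hu_lt n).2
    exact ⟨_, (isCompact_dominated b).image hf, Set.image_subset_range _ _,
      le_measure_image_dominated μ hf fun m => (hb m).le.trans (measure_mono subset_closure)⟩
  choose K hKc hKS hKu using hK
  have hGm : MeasurableSet (⋃ n, K n) := MeasurableSet.iUnion fun n => (hKc n).measurableSet
  have hGS : (⋃ n, K n) ⊆ S := Set.iUnion_subset hKS
  have hle : μ S ≤ μ (⋃ n, K n) :=
    le_of_tendsto' hu_lim fun n => (hKu n).trans (measure_mono (Set.subset_iUnion K n))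
  have hsub : (⋃ n, K n) ⊆ toMeasurable μ S := hGS.trans (subset_toMeasurable μ S)
  have hae : (⋃ n, K n) =ᵐ[μ] toMeasurable μ S := by
    refine ae_eq_of_subset_of_measure_ge hsub ?_ hGm.nullMeasurableSet (measure_ne_top _ _)
    rw [measure_toMeasurable]
    exact hle
  have hSae : S =ᵐ[μ] ⋃ n, K n :=
    Filter.EventuallyLE.antisymm
      ((subset_toMeasurable μ S).eventuallyLE.trans hae.symm.le) hGS.eventuallyLE
  exact hGm.nullMeasurableSet.congr hSae.symm

end Analytic

/-! ### The universal σ-algebra and measurable selection -/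

section Universal

variable {α β γ : Type*}

/-- The σ-algebra of universally measurable sets. -/
@[reducible] def umSpace (α : Type*) [MeasurableSpace α] : MeasurableSpace α where
  MeasurableSet' := UniversallyMeasurableSet
  measurableSet_empty := fun _ _ => nullMeasurableSet_empty
  measurableSet_compl := fun _ hs μ hμ => (hs μ hμ).compl
  measurableSet_iUnion := fun _ hs μ hμ => NullMeasurableSet.iUnion fun i => hs i μ hμ

theorem le_umSpace (α : Type*) [m : MeasurableSpace α] : m ≤ umSpace α :=
  fun _ hs _ _ => hs.nullMeasurableSet

theorem _root_.Measurable.universallyMeasurable [MeasurableSpace α] [MeasurableSpace β]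
    {f : α → β} (hf : Measurable f) : Measurable[umSpace α] f :=
  hf.mono (le_umSpace α) le_rfl

theorem _root_.MeasureTheory.AnalyticSet.measurableSet_umSpace [TopologicalSpace α] [T2Space α]
    [MeasurableSpace α] [OpensMeasurableSpace α] {s : Set α} (hs : AnalyticSet s) :
    MeasurableSet[umSpace α] s := fun μ _ => hs.nullMeasurableSet μ

theorem aemeasurable_of_umSpace [MeasurableSpace α] [MeasurableSpace β]
    [MeasurableSpace.CountablyGenerated β] {f : α → β} (hf : Measurable[umSpace α] f)
    (μ : Measure α) [IsProbabilityMeasure μ] : AEMeasurable f μ :=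
  NullMeasurable.aemeasurable fun _ hs => hf hs μ inferInstance

theorem nullMeasurableSet_preimage [MeasurableSpace α] [MeasurableSpace β] {f : α → β}
    {μ : Measure α} (hf : AEMeasurable f μ) {s : Set β} (hs : NullMeasurableSet s (μ.map f)) :
    NullMeasurableSet (f ⁻¹' s) μ := by
  rw [Measure.map_congr hf.ae_eq_mk] at hs
  refine (hs.preimage (hf.measurable_mk.quasiMeasurePreserving μ)).congr ?_
  filter_upwards [hf.ae_eq_mk] with x hx
  exact congrArg (fun y => s y) hx.symm

/-- Universally measurable maps pull universally measurable sets back to universally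
measurable sets. -/
theorem measurable_umSpace_umSpace [MeasurableSpace α] [MeasurableSpace β]
    [MeasurableSpace.CountablyGenerated β] {f : α → β} (hf : Measurable[umSpace α] f) :
    Measurable[umSpace α, umSpace β] f := by
  intro s hs μ hμ
  have hfa := aemeasurable_of_umSpace hf μ
  have := Measure.isProbabilityMeasure_map hfa
  exact nullMeasurableSet_preimage hfa (hs _ this)

theorem measurable_sInf_nat {m : MeasurableSpace α} {p : α → ℕ → Prop}
    (hp : ∀ j, MeasurableSet {x | p x j}) : Measurable fun x => sInf {j | p x j} := by
  refine measurable_to_countable' fun j => ?_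
  have h : (fun x => sInf {j | p x j}) ⁻¹' {j} =
      ({x | p x j} ∩ ⋂ i : ℕ, {x | i < j → ¬ p x i}) ∪ ((⋂ i, {x | p x i}ᶜ) ∩ {_x | j = 0}) := by
    ext x
    simp only [Set.mem_preimage, Set.mem_singleton_iff, Set.mem_union, Set.mem_inter_iff,
      Set.mem_ofPred_eq, Set.mem_iInter, Set.mem_compl_iff]
    constructor
    · rintro rfl
      by_cases hex : ∃ i, p x i
      · exact Or.inl ⟨Nat.sInf_mem hex, fun i hi => Nat.notMem_of_lt_sInf hi⟩
      · push Not at hex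
        refine Or.inr ⟨hex, ?_⟩
        have : {j | p x j} = ∅ := Set.eq_empty_iff_forall_notMem.2 hex
        rw [this, Nat.sInf_empty]
    · rintro (⟨h1, h2⟩ | ⟨h1, rfl⟩)
      · refine le_antisymm (Nat.sInf_le h1) ?_
        by_contra! hlt
        exact h2 _ hlt (Nat.sInf_mem (s := {j | p x j}) ⟨j, h1⟩)
      · have : {j | p x j} = ∅ := Set.eq_empty_iff_forall_notMem.2 h1
        rw [this, Nat.sInf_empty]
  rw [h]
  refine ((hp j).inter (MeasurableSet.iInter fun i => ?_)).union
    ((MeasurableSet.iInter fun i => (hp i).compl).inter (MeasurableSet.const _))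
  by_cases hij : i < j
  · simp only [hij, true_imp_iff]
    exact (hp i).compl
  · simp [hij]

/-- The sequences agreeing with `a` before `n`. -/
def prefixCylinder (a : ℕ → ℕ) (n : ℕ) : Set (ℕ → ℕ) := {z | ∀ i < n, z i = a i}

theorem isClosed_prefixCylinder (a : ℕ → ℕ) (n : ℕ) : IsClosed (prefixCylinder a n) := by
  have : prefixCylinder a n = ⋂ (i : ℕ) (_ : i < n), (fun z : ℕ → ℕ => z i) ⁻¹' {a i} := by
    ext z; simp [prefixCylinder]
  rw [this]
  exact isClosed_iInter fun i => isClosed_iInter fun _ =>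
    (isClosed_discrete _).preimage (continuous_apply i)

/-- The leftmost branch of the tree of prefixes of sequences mapped to `x` by `g`: the set of
sequences extending its first `n` entries. -/
def leftmostCylinder (g : (ℕ → ℕ) → α) (x : α) (n : ℕ) : Set (ℕ → ℕ) :=
  Nat.rec Set.univ (fun n S => S ∩ {z | z n = sInf {j | x ∈ g '' (S ∩ {z | z n = j})}}) n

/-- The leftmost branch of the tree of prefixes of sequences mapped to `x` by `g`. -/
def leftmostBranch (g : (ℕ → ℕ) → α) (x : α) (n : ℕ) : ℕ :=
  sInf {j | x ∈ g '' (leftmostCylinder g x n ∩ {z | z n = j})}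

theorem leftmostCylinder_eq (g : (ℕ → ℕ) → α) (x : α) (n : ℕ) :
    leftmostCylinder g x n = prefixCylinder (leftmostBranch g x) n := by
  induction n with
  | zero => ext z; simp [leftmostCylinder, prefixCylinder]
  | succ n ih =>
    have : leftmostCylinder g x (n + 1) =
      leftmostCylinder g x n ∩ {z | z n = leftmostBranch g x n} := rfl
    rw [this, ih]
    ext z
    simp only [prefixCylinder, Set.mem_inter_iff, Set.mem_ofPred_eq, Nat.lt_succ_iff_lt_or_eq]
    constructor
    · rintro ⟨h1, h2⟩ i (hi | rfl)
      exacts [h1 i hi, h2]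
    · exact fun h => ⟨fun i hi => h i (Or.inl hi), h n (Or.inr rfl)⟩

theorem mem_image_leftmostCylinder {g : (ℕ → ℕ) → α} {x : α} (hx : x ∈ Set.range g) (n : ℕ) :
    x ∈ g '' leftmostCylinder g x n := by
  induction n with
  | zero => simpa [leftmostCylinder] using hx
  | succ n ih =>
    obtain ⟨z, hz, hzx⟩ := ih
    exact Nat.sInf_mem (s := {j | x ∈ g '' (leftmostCylinder g x n ∩ {z | z n = j})})
      ⟨z n, z, ⟨hz, rfl⟩, hzx⟩

theorem apply_leftmostBranch [TopologicalSpace α] [T2Space α] {g : (ℕ → ℕ) → α}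
    (hg : Continuous g) {x : α} (hx : x ∈ Set.range g) : g (leftmostBranch g x) = x := by
  choose z hz hzx using fun n => mem_image_leftmostCylinder hx n
  have hlim : Tendsto z atTop (𝓝 (leftmostBranch g x)) := by
    rw [tendsto_pi_nhds]
    intro i
    refine tendsto_const_nhds.congr' ?_
    filter_upwards [eventually_gt_atTop i] with n hn
    have := hz n
    rw [leftmostCylinder_eq] at this
    exact (this i hn).symm
  refine tendsto_nhds_unique ((hg.tendsto _).comp hlim) ?_
  simp only [Function.comp_def, hzx]
  exact tendsto_const_nhds

theorem measurable_leftmostBranch [TopologicalSpace α] [T2Space α] [MeasurableSpace α]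
    [OpensMeasurableSpace α] {g : (ℕ → ℕ) → α} (hg : Continuous g) :
    Measurable[umSpace α] (leftmostBranch g) := by
  refine (@measurable_pi_iff _ _ _ (umSpace α) _ _).2 fun n => ?_
  induction n using Nat.strong_induction_on with
  | _ n ih =>
    refine @measurable_sInf_nat _ (umSpace α) _ fun j => ?_
    have h : {x | x ∈ g '' (leftmostCylinder g x n ∩ {z | z n = j})} =
        ⋃ u : Fin n → ℕ, (⋂ i : Fin n, (fun x => leftmostBranch g x i) ⁻¹' {u i}) ∩
          g '' (prefixCylinder (fun i => if h : i < n then u ⟨i, h⟩ else 0) n ∩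
            {z | z n = j}) := by
      have hcyl : ∀ (x : α) (u : Fin n → ℕ), (∀ i : Fin n, leftmostBranch g x i = u i) →
          leftmostCylinder g x n =
            prefixCylinder (fun i => if h : i < n then u ⟨i, h⟩ else 0) n := by
        intro x u hu
        rw [leftmostCylinder_eq]
        ext z
        refine forall₂_congr fun i hi => ?_
        simp [hi, ← hu ⟨i, hi⟩]
      ext x
      simp only [Set.mem_iUnion, Set.mem_inter_iff, Set.mem_iInter, Set.mem_preimage,
        Set.mem_singleton_iff]
      constructor
      · intro hx
        refine ⟨fun i => leftmostBranch g x i, fun i => rfl, ?_⟩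
        rw [← hcyl x _ fun i => rfl]
        exact hx
      · rintro ⟨u, hu, hx⟩
        change x ∈ g '' (leftmostCylinder g x n ∩ {z | z n = j})
        rw [hcyl x u hu]
        exact hx
    rw [h]
    refine @MeasurableSet.iUnion _ _ (umSpace α) _ _ fun u =>
      @MeasurableSet.inter _ (umSpace α) _ _
        (@MeasurableSet.iInter _ _ (umSpace α) _ _ fun i => ih i i.2 (measurableSet_singleton _))
        (AnalyticSet.measurableSet_umSpace ?_)
    have hcl : IsClosed {z : ℕ → ℕ | z n = j} :=
      isClosed_eq (continuous_apply n) continuous_const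
    exact ((isClosed_prefixCylinder _ n).inter hcl).analyticSet.image_of_continuous hg

/-- **Jankov–von Neumann selection theorem**. -/
theorem exists_selection [TopologicalSpace α] [T2Space α] [MeasurableSpace α]
    [OpensMeasurableSpace α] [TopologicalSpace β] [MeasurableSpace β] [BorelSpace β] [Nonempty β]
    {E : Set (α × β)} (hE : AnalyticSet E) :
    ∃ φ : α → β, Measurable[umSpace α] φ ∧ ∀ x y, (x, y) ∈ E → (x, φ x) ∈ E := by
  rw [AnalyticSet] at hE
  rcases hE with rfl | ⟨f, hf, rfl⟩
  · exact ⟨fun _ => Classical.arbitrary β, @measurable_const _ _ _ (umSpace α) _, fun x y h => h⟩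
  have hg : Continuous fun z => (f z).1 := continuous_fst.comp hf
  refine ⟨fun x => (f (leftmostBranch (fun z => (f z).1) x)).2, ?_, ?_⟩
  · exact (continuous_snd.comp hf).measurable.comp (measurable_leftmostBranch hg)
  · rintro x y ⟨z, hz⟩
    have := apply_leftmostBranch hg (x := x) ⟨z, by simp [hz]⟩
    exact ⟨leftmostBranch (fun z => (f z).1) x, Prod.ext this rfl⟩

end Universal

/-! ### The space of probability measures on a Polish space -/

section Prob

variable {α β γ δ : Type*}

theorem _root_.MeasurableEquiv.standardBorelSpace [MeasurableSpace γ] [MeasurableSpace δ]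
    [StandardBorelSpace δ] (e : γ ≃ᵐ δ) : StandardBorelSpace γ := by
  obtain ⟨τ, hb, hp⟩ := StandardBorelSpace.polish (α := δ)
  refine ⟨⟨τ.induced e, @BorelSpace.mk _ (τ.induced e) _ ?_, e.toEquiv.polishSpace_induced⟩⟩
  refine Eq.trans ?_ borel_comap.symm
  rw [← hb.measurable_eq, e.measurableEmbedding.comap_eq]

instance instBorelSpaceProb [MeasurableSpace α] [TopologicalSpace α] [OpensMeasurableSpace α] :
    BorelSpace (ProbabilityMeasure α) := ⟨rfl⟩

theorem measurable_prob_apply [TopologicalSpace α] [TopologicalSpace.PseudoMetrizableSpace α]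
    [MeasurableSpace α] [BorelSpace α] {s : Set α} (hs : MeasurableSet s) :
    Measurable fun p : ProbabilityMeasure α => p.toMeasure s := by
  induction s, hs using MeasurableSpace.induction_on_inter
    (BorelSpace.measurable_eq (α := α)) isPiSystem_isOpen with
  | empty => simp
  | basic s hs =>
    refine LowerSemicontinuous.measurable fun p => ?_
    exact lowerSemicontinuousAt_iff_le_liminf.2 <|
      ProbabilityMeasure.le_liminf_measure_open_of_tendsto tendsto_id hs
  | compl s hs ih =>
    simp_rw [prob_compl_eq_one_sub hs]
    exact measurable_const.sub ih
  | iUnion f hd hm ih =>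
    simp_rw [measure_iUnion hd hm]
    exact Measurable.tsum ih

section Embedding

variable [TopologicalSpace α] [MeasurableSpace α] [BorelSpace α]
  [TopologicalSpace β] [MeasurableSpace β] [BorelSpace β]

/-- The push-forward of probability measures under an embedding. -/
def probMap (e : α → β) (he : Topology.IsEmbedding e) (p : ProbabilityMeasure α) :
    ProbabilityMeasure β :=
  p.map (f := e) he.continuous.measurable.aemeasurable

theorem probMap_apply {e : α → β} (he : Topology.IsEmbedding e) (p : ProbabilityMeasure α)
    {s : Set β} (hs : MeasurableSet s) :
    (probMap e he p).toMeasure s = p.toMeasure (e ⁻¹' s) := by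
  rw [probMap, ProbabilityMeasure.toMeasure_map, Measure.map_apply he.continuous.measurable hs]

theorem isEmbedding_probMap [TopologicalSpace.PseudoMetrizableSpace α]
    [TopologicalSpace.SeparableSpace α]
    [TopologicalSpace.PseudoMetrizableSpace β] [TopologicalSpace.SeparableSpace β] {e : α → β}
    (he : Topology.IsEmbedding e) :
    Topology.IsEmbedding (probMap e he) := by
  have hind : Topology.IsInducing (probMap e he) := by
    rw [Topology.isInducing_iff_nhds]
    intro p
    have hcont : Continuous (probMap e he) := ProbabilityMeasure.continuous_map he.continuous
    refine le_antisymm (Filter.map_le_iff_le_comap.1 (hcont.tendsto p)) ?_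
    have : Tendsto (fun p' : ProbabilityMeasure α => p')
        (comap (probMap e he) (𝓝 (probMap e he p))) (𝓝 p) := by
      refine tendsto_of_forall_isOpen_le_liminf' fun G hG => ?_
      obtain ⟨V, hV, rfl⟩ := he.isOpen_iff.1 hG
      have h := ProbabilityMeasure.le_liminf_measure_open_of_tendsto
        (tendsto_comap (f := probMap e he) (x := 𝓝 (probMap e he p))) hV
      simpa only [probMap_apply he _ hV.measurableSet] using h
    exact this
  exact hind.isEmbedding

theorem range_probMap [T2Space β] {e : α → β} (he : Topology.IsEmbedding e)
    (hem : MeasurableEmbedding e) :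
    Set.range (probMap e he) = {ν | ν.toMeasure (Set.range e) = 1} := by
  ext ν
  constructor
  · rintro ⟨p, rfl⟩
    simp [probMap_apply he p hem.measurableSet_range]
  · intro hν
    have hae : ∀ᵐ x ∂ν.toMeasure, x ∈ Set.range e :=
      (prob_compl_eq_zero_iff hem.measurableSet_range).2 hν
    have hp : IsProbabilityMeasure (ν.toMeasure.comap e) := by
      refine ⟨?_⟩
      rw [hem.comap_apply, Set.image_univ]
      exact hν
    refine ⟨⟨ν.toMeasure.comap e, hp⟩, Subtype.ext ?_⟩
    change (ν.toMeasure.comap e).map e = ν.toMeasure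
    rw [hem.map_comap, Measure.restrict_eq_self_of_ae_mem hae]

end Embedding

variable [TopologicalSpace α] [PolishSpace α] [MeasurableSpace α] [BorelSpace α]

theorem exists_isEmbedding_hilbertCube (α : Type*) [TopologicalSpace α] [PolishSpace α] :
    ∃ e : α → ℕ → unitInterval, Topology.IsEmbedding e := by
  let := TopologicalSpace.upgradeIsCompletelyMetrizable α
  exact Metric.PiNatEmbed.exists_embedding_to_hilbert_cube

instance instSecondCountableProb : SecondCountableTopology (ProbabilityMeasure α) := by
  obtain ⟨e, he⟩ := exists_isEmbedding_hilbertCube α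
  have h1 : SecondCountableTopology (ProbabilityMeasure (ℕ → unitInterval)) := by
    let := TopologicalSpace.metrizableSpaceMetric (ProbabilityMeasure (ℕ → unitInterval))
    infer_instance
  exact (isEmbedding_probMap he).secondCountableTopology

instance instStandardBorelProb : StandardBorelSpace (ProbabilityMeasure α) := by
  obtain ⟨e, he⟩ := exists_isEmbedding_hilbertCube α
  have hem : MeasurableEmbedding e := he.continuous.measurableEmbedding he.injective
  have h1 : PolishSpace (ProbabilityMeasure (ℕ → unitInterval)) := by
    let := TopologicalSpace.metrizableSpaceMetric (ProbabilityMeasure (ℕ → unitInterval))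
    infer_instance
  have hr : MeasurableSet (Set.range (probMap e he)) := by
    rw [range_probMap he hem]
    exact measurable_prob_apply hem.measurableSet_range (measurableSet_singleton 1)
  have := hr.standardBorel
  exact (isEmbedding_probMap he).toHomeomorph.toMeasurableEquiv.standardBorelSpace

theorem measure_ext_of_natGeneratingSequence {μ ν : Measure α} [IsProbabilityMeasure μ]
    [IsProbabilityMeasure ν]
    (h : ∀ t : Finset ℕ, μ (⋂ i ∈ t, MeasurableSpace.natGeneratingSequence α i) =
      ν (⋂ i ∈ t, MeasurableSpace.natGeneratingSequence α i)) : μ = ν := by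
  refine MeasureTheory.ext_of_generate_finite
    (Set.range fun t : Finset ℕ => ⋂ i ∈ t, MeasurableSpace.natGeneratingSequence α i) ?_ ?_ ?_ ?_
  · refine le_antisymm ?_ ?_
    · conv_lhs => rw [← MeasurableSpace.generateFrom_natGeneratingSequence α]
      refine MeasurableSpace.generateFrom_mono ?_
      rintro _ ⟨i, rfl⟩
      exact ⟨{i}, by simp⟩
    · refine MeasurableSpace.generateFrom_le ?_
      rintro _ ⟨t, rfl⟩
      exact t.measurableSet_biInter fun i _ =>
        MeasurableSpace.measurableSet_natGeneratingSequence i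
  · rintro _ ⟨t, rfl⟩ _ ⟨u, rfl⟩ -
    refine ⟨t ∪ u, ?_⟩
    simp only [Finset.mem_union, Set.iInter_or, Set.iInter_inter_distrib]
  · rintro _ ⟨t, rfl⟩
    exact h t
  · simp

theorem measurable_prob_iff {m : MeasurableSpace γ} {f : γ → ProbabilityMeasure α} :
    Measurable f ↔ ∀ s, MeasurableSet s → Measurable fun x => (f x).toMeasure s := by
  refine ⟨fun hf s hs => (measurable_prob_apply hs).comp hf, fun hf => ?_⟩
  let ev : ProbabilityMeasure α → Finset ℕ → ℝ≥0∞ := fun p t =>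
    p.toMeasure (⋂ i ∈ t, MeasurableSpace.natGeneratingSequence α i)
  have hms : ∀ t : Finset ℕ, MeasurableSet
      (⋂ i ∈ t, MeasurableSpace.natGeneratingSequence α i) := fun t =>
    t.measurableSet_biInter fun i _ => MeasurableSpace.measurableSet_natGeneratingSequence i
  have hev : MeasurableEmbedding ev := by
    refine Measurable.measurableEmbedding
      (measurable_pi_iff.2 fun t => measurable_prob_apply (hms t)) fun p p' h => Subtype.ext ?_
    change p.toMeasure = p'.toMeasure
    exact measure_ext_of_natGeneratingSequence fun t => congrFun h t
  rw [← hev.measurable_comp_iff]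
  exact measurable_pi_iff.2 fun t => hf _ (hms t)

theorem measurable_prob_iff_measure {m : MeasurableSpace γ} {f : γ → ProbabilityMeasure α} :
    Measurable f ↔ Measurable fun x => (f x).toMeasure := by
  rw [measurable_prob_iff]
  exact ⟨Measure.measurable_of_measurable_coe _, fun h s hs => (Measure.measurable_coe hs).comp h⟩

theorem measurable_toMeasure :
    Measurable fun p : ProbabilityMeasure α => p.toMeasure :=
  measurable_prob_iff_measure.1 measurable_id

theorem measurableSet_range_diracProba :
    MeasurableSet (Set.range (diracProba : α → ProbabilityMeasure α)) :=
  MeasureTheory.measurableSet_range_of_continuous_injective continuous_diracProba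
    injective_diracProba

end Prob

/-! ### Lower and upper semianalytic functions -/

section Semianalytic

variable {γ δ L M : Type*}

/-- Preimages of lower sets are analytic: lower semianalyticity for functions with values in a
general preorder. -/
def LSA [TopologicalSpace γ] [Preorder L] (f : γ → L) : Prop :=
  ∀ D : Set L, IsLowerSet D → AnalyticSet (Set.preimage f D)

/-- Preimages of upper sets are analytic: upper semianalyticity for functions with values in a
general preorder. -/
def USA [TopologicalSpace γ] [Preorder L] (f : γ → L) : Prop :=
  LSA fun x => OrderDual.toDual (f x)

section Order

variable [TopologicalSpace γ] [Preorder L] [Preorder M] {f : γ → L}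

theorem LSA.lt (hf : LSA f) (t : L) : AnalyticSet {x | f x < t} := hf _ (isLowerSet_Iio t)

theorem LSA.le (hf : LSA f) (t : L) : AnalyticSet {x | f x ≤ t} := hf _ (isLowerSet_Iic t)

theorem USA.lt (hf : USA f) (t : L) : AnalyticSet {x | t < f x} := LSA.lt hf (OrderDual.toDual t)

theorem USA.le (hf : USA f) (t : L) : AnalyticSet {x | t ≤ f x} := LSA.le hf (OrderDual.toDual t)

theorem LSA.comp_monotone (hf : LSA f) {φ : L → M} (hφ : Monotone φ) : LSA fun x => φ (f x) :=
  fun D hD => hf (φ ⁻¹' D) fun _ _ hab ha => hD (hφ hab) ha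

theorem USA.comp_monotone (hf : USA f) {φ : L → M} (hφ : Monotone φ) : USA fun x => φ (f x) :=
  LSA.comp_monotone hf (φ := fun y : Lᵒᵈ => OrderDual.toDual (φ (OrderDual.ofDual y)))
    fun _ _ h => hφ h

theorem LSA.comp_antitone (hf : LSA f) {φ : L → M} (hφ : Antitone φ) : USA fun x => φ (f x) :=
  LSA.comp_monotone hf (φ := fun y => OrderDual.toDual (φ y)) fun _ _ h => hφ h

theorem USA.comp_antitone (hf : USA f) {φ : L → M} (hφ : Antitone φ) : LSA fun x => φ (f x) :=
  LSA.comp_monotone hf (φ := fun y : Lᵒᵈ => φ (OrderDual.ofDual y)) fun _ _ h => hφ h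

theorem LSA.comp_measurable [T2Space γ] [SecondCountableTopology γ] [MeasurableSpace γ]
    [BorelSpace γ] [TopologicalSpace δ] [SecondCountableTopology δ] [MeasurableSpace δ]
    [OpensMeasurableSpace δ] [StandardBorelSpace δ] (hf : LSA f) {u : δ → γ} (hu : Measurable u) :
    LSA fun x => f (u x) :=
  fun D hD => (hf D hD).preimage_measurable hu

end Order

variable [TopologicalSpace γ] [T2Space γ] [SecondCountableTopology γ] [MeasurableSpace γ]
  [BorelSpace γ] [StandardBorelSpace γ]

section Complete

variable [CompleteLinearOrder L] [DenselyOrdered L] [TopologicalSpace L] [OrderTopology L]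
  [TopologicalSpace.SeparableSpace L] {f : γ → L}

theorem exists_denseSeq_btwn {s t : L} (h : s < t) :
    ∃ n, s < TopologicalSpace.denseSeq L n ∧ TopologicalSpace.denseSeq L n < t := by
  obtain ⟨_, ⟨n, rfl⟩, hn⟩ := (TopologicalSpace.denseRange_denseSeq L).exists_between h
  exact ⟨n, hn⟩

theorem LSA.of_lt (h : ∀ t, AnalyticSet {x | f x < t}) : LSA f := by
  intro D hD
  by_cases hs : sSup D ∈ D
  · have hDeq : f ⁻¹' D = ⋂ n : ℕ, {x | sSup D < TopologicalSpace.denseSeq L n →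
        f x < TopologicalSpace.denseSeq L n} := by
      ext x
      simp only [Set.mem_preimage, Set.mem_iInter, Set.mem_ofPred_eq]
      refine ⟨fun hx n hn => (le_sSup hx).trans_lt hn, fun hx => ?_⟩
      by_contra hxD
      have hlt : sSup D < f x := lt_of_not_ge fun hle => hxD (hD hle hs)
      obtain ⟨n, h1, h2⟩ := exists_denseSeq_btwn hlt
      exact lt_asymm h2 (hx n h1)
    rw [hDeq]
    refine AnalyticSet.iInter fun n => ?_
    by_cases hn : sSup D < TopologicalSpace.denseSeq L n
    · simpa only [hn, true_imp_iff] using h _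
    · simp only [hn, false_imp_iff]
      exact (MeasurableSet.const True).analyticSet'
  · have hDeq : D = Set.Iio (sSup D) := by
      ext y
      refine ⟨fun hy => lt_of_le_of_ne (le_sSup hy) fun h => hs (h ▸ hy), fun hy => ?_⟩
      obtain ⟨d, hd, hyd⟩ := lt_sSup_iff.1 hy
      exact hD hyd.le hd
    rw [hDeq]
    exact h _

theorem USA.of_lt (h : ∀ t, AnalyticSet {x | t < f x}) : USA f :=
  LSA.of_lt (L := Lᵒᵈ) h

theorem LSA.measurable_umSpace [SecondCountableTopology L] [MeasurableSpace L] [BorelSpace L]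
    (hf : LSA f) : Measurable[umSpace γ] f :=
  measurable_of_Iio (mδ := umSpace γ) fun t => (hf.lt t).measurableSet_umSpace

theorem USA.measurable_umSpace [SecondCountableTopology L] [MeasurableSpace L] [BorelSpace L]
    (hf : USA f) : Measurable[umSpace γ] f :=
  measurable_of_Ioi (mδ := umSpace γ) fun t => (hf.lt t).measurableSet_umSpace

theorem LSA.iInf {ι : Type*} [Countable ι] {f : ι → γ → L} (hf : ∀ i, LSA (f i)) :
    LSA fun x => ⨅ i, f i x := by
  refine LSA.of_lt fun t => ?_
  simp only [iInf_lt_iff, Set.ofPred_exists]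
  exact AnalyticSet.iUnion fun i => (hf i).lt t

theorem LSA.iSup {ι : Type*} [Countable ι] [Nonempty ι] {f : ι → γ → L} (hf : ∀ i, LSA (f i)) :
    LSA fun x => ⨆ i, f i x := by
  refine LSA.of_lt fun t => ?_
  have : {x | ⨆ i, f i x < t} = ⋃ n : {n // TopologicalSpace.denseSeq L n < t},
      ⋂ i, {x | f i x ≤ TopologicalSpace.denseSeq L n} := by
    ext x
    simp only [Set.mem_ofPred_eq, Set.mem_iUnion, Set.mem_iInter]
    constructor
    · intro h
      obtain ⟨n, h1, h2⟩ := exists_denseSeq_btwn h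
      exact ⟨⟨n, h2⟩, fun i => (le_iSup (fun i => f i x) i).trans h1.le⟩
    · rintro ⟨⟨n, hn⟩, h⟩
      exact (iSup_le h).trans_lt hn
  rw [this]
  exact AnalyticSet.iUnion fun n => AnalyticSet.iInter fun i => (hf i).le _

theorem LSA.limsup {f : ℕ → γ → L} (hf : ∀ n, LSA (f n)) :
    LSA fun x => limsup (fun n => f n x) atTop := by
  simp only [limsup_eq_iInf_iSup_of_nat']
  exact LSA.iInf fun n => LSA.iSup fun i => hf _

theorem LSA.liminf {f : ℕ → γ → L} (hf : ∀ n, LSA (f n)) :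
    LSA fun x => liminf (fun n => f n x) atTop := by
  simp only [liminf_eq_iSup_iInf_of_nat']
  exact LSA.iSup fun n => LSA.iInf fun i => hf _

theorem LSA.analyticSet_epigraph [SecondCountableTopology L] [MeasurableSpace L] [BorelSpace L]
    [StandardBorelSpace (γ × L)] (hf : LSA f) : AnalyticSet {z : γ × L | f z.1 ≤ z.2} := by
  have : {z : γ × L | f z.1 ≤ z.2} = ⋂ n, {z | TopologicalSpace.denseSeq L n ≤ z.2} ∪
      {z | f z.1 < TopologicalSpace.denseSeq L n} := by
    ext z
    simp only [Set.mem_ofPred_eq, Set.mem_iInter, Set.mem_union]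
    refine ⟨fun hz n => (le_or_gt _ z.2).imp_right fun h' => hz.trans_lt h', fun hz => ?_⟩
    by_contra hcon
    obtain ⟨n, h1, h2⟩ := exists_denseSeq_btwn (not_le.1 hcon)
    exact (hz n).elim (not_le.2 h1) (lt_asymm h2)
  rw [this]
  exact AnalyticSet.iInter fun n => (measurableSet_le measurable_const
    measurable_snd).analyticSet'.union ((hf.lt _).preimage_measurable measurable_fst)

theorem USA.analyticSet_hypograph [SecondCountableTopology L] [MeasurableSpace L] [BorelSpace L]
    [StandardBorelSpace (γ × L)] (hf : USA f) : AnalyticSet {z : γ × L | z.2 ≤ f z.1} := by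
  have : {z : γ × L | z.2 ≤ f z.1} = ⋂ n, {z | z.2 ≤ TopologicalSpace.denseSeq L n} ∪
      {z | TopologicalSpace.denseSeq L n < f z.1} := by
    ext z
    simp only [Set.mem_ofPred_eq, Set.mem_iInter, Set.mem_union]
    refine ⟨fun hz n => (le_or_gt z.2 _).imp_right fun h' => h'.trans_le hz, fun hz => ?_⟩
    by_contra hcon
    obtain ⟨n, h1, h2⟩ := exists_denseSeq_btwn (not_le.1 hcon)
    exact (hz n).elim (not_le.2 h2) (lt_asymm h1)
  rw [this]
  exact AnalyticSet.iInter fun n => (measurableSet_le measurable_snd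
    measurable_const).analyticSet'.union ((hf.lt _).preimage_measurable measurable_fst)

end Complete

theorem LSA.const_lsa [Preorder L] (a : L) : LSA fun _ : γ => a :=
  fun _ _ => (MeasurableSet.const _).analyticSet'

theorem USA.const_usa [Preorder L] (a : L) : USA fun _ : γ => a :=
  LSA.const_lsa (OrderDual.toDual a)

theorem lowerSemianalytic_iff_lsa {f : γ → EReal} : LowerSemianalytic f ↔ LSA f := by
  refine ⟨fun h => LSA.of_lt fun t => ?_, fun h r => h.le r⟩
  have : {x | f x < t} = ⋃ r : {r : ℚ // ((r : ℝ) : EReal) < t}, {x | f x ≤ ((r : ℝ) : EReal)} := by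
    ext x
    simp only [Set.mem_ofPred_eq, Set.mem_iUnion]
    constructor
    · intro hx
      obtain ⟨r, h1, h2⟩ := EReal.lt_iff_exists_rat_btwn.1 hx
      exact ⟨⟨r, h2⟩, h1.le⟩
    · rintro ⟨⟨r, hr⟩, h⟩
      exact lt_of_le_of_lt h hr
  rw [this]
  exact AnalyticSet.iUnion fun r => h r

theorem LSA.add_ennreal {f g : γ → ℝ≥0∞} (hf : LSA f) (hg : LSA g) : LSA fun x => f x + g x := by
  refine LSA.of_lt fun t => ?_
  have : {x | f x + g x < t} = ⋃ n : ℕ, {x | f x < TopologicalSpace.denseSeq ℝ≥0∞ n} ∩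
      {x | TopologicalSpace.denseSeq ℝ≥0∞ n + g x < t} := by
    ext x
    simp only [Set.mem_ofPred_eq, Set.mem_iUnion, Set.mem_inter_iff]
    constructor
    · intro h
      obtain ⟨n, h1, h2⟩ := exists_denseSeq_btwn (lt_tsub_iff_right.2 h)
      exact ⟨n, h1, lt_tsub_iff_right.1 h2⟩
    · rintro ⟨n, h1, h2⟩
      exact (add_le_add_left h1.le _).trans_lt h2
  rw [this]
  exact AnalyticSet.iUnion fun n => (hf.lt _).inter
    ((hg.comp_monotone (φ := fun y => TopologicalSpace.denseSeq ℝ≥0∞ n + y)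
      fun _ _ h => add_le_add_right h _).lt t)

theorem USA.add_ennreal {f g : γ → ℝ≥0∞} (hf : USA f) (hg : USA g) : USA fun x => f x + g x := by
  refine USA.of_lt fun t => ?_
  have : {x | t < f x + g x} = {x | t < g x} ∪
      ⋃ n : ℕ, {x | TopologicalSpace.denseSeq ℝ≥0∞ n < f x} ∩
      {x | t < TopologicalSpace.denseSeq ℝ≥0∞ n + g x} := by
    ext x
    simp only [Set.mem_ofPred_eq, Set.mem_iUnion, Set.mem_inter_iff, Set.mem_union]
    constructor
    · intro h
      by_cases hgt : t < g x
      · exact Or.inl hgt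
      · have hg' : g x ≠ ⊤ := by
          rintro h'
          rw [h'] at hgt
          have : t = ⊤ := by simpa using hgt
          exact not_top_lt (this ▸ h)
        have hlt : t - g x < f x := by
          rw [ENNReal.sub_lt_iff_lt_right hg' (not_lt.1 hgt)]
          exact h
        obtain ⟨n, h1, h2⟩ := exists_denseSeq_btwn hlt
        refine Or.inr ⟨n, h2, ?_⟩
        rwa [ENNReal.sub_lt_iff_lt_right hg' (not_lt.1 hgt)] at h1
    · rintro (h | ⟨n, h1, h2⟩)
      · exact h.trans_le le_add_self
      · exact h2.trans_le (add_le_add_left h1.le _)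
  rw [this]
  exact (hg.lt t).union <| AnalyticSet.iUnion fun n => (hf.lt _).inter
    ((hg.comp_monotone (φ := fun y => TopologicalSpace.denseSeq ℝ≥0∞ n + y)
      fun _ _ h => add_le_add_right h _).lt t)

theorem LSA.sum_ennreal {ι : Type*} (s : Finset ι) {f : ι → γ → ℝ≥0∞} (hf : ∀ i, LSA (f i)) :
    LSA fun x => ∑ i ∈ s, f i x := by
  classical
  induction s using Finset.induction_on with
  | empty => simpa using LSA.const_lsa _
  | insert a s ha ih =>
    simp only [Finset.sum_insert ha]
    exact (hf a).add_ennreal ih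

theorem USA.sum_ennreal {ι : Type*} (s : Finset ι) {f : ι → γ → ℝ≥0∞} (hf : ∀ i, USA (f i)) :
    USA fun x => ∑ i ∈ s, f i x := by
  classical
  induction s using Finset.induction_on with
  | empty =>
    simp only [Finset.sum_empty]
    exact USA.const_usa 0
  | insert a s ha ih =>
    simp only [Finset.sum_insert ha]
    exact (hf a).add_ennreal ih

theorem LSA.ediff {u w : γ → ℝ≥0∞} (hu : LSA u) (hw : USA w) :
    LSA fun x => if u x = ⊤ then (⊤ : EReal) else (u x : EReal) - (w x : EReal) := by
  refine LSA.of_lt fun t => ?_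
  have : {x | (if u x = ⊤ then (⊤ : EReal) else (u x : EReal) - (w x : EReal)) < t} =
      ⋃ q : ℚ, {x | u x < ENNReal.ofReal q} ∩
      {x | ((ENNReal.ofReal q : ℝ≥0∞) : EReal) - (w x : EReal) < t} := by
    ext x
    simp only [Set.mem_ofPred_eq, Set.mem_iUnion, Set.mem_inter_iff]
    constructor
    · intro h
      have hut : u x ≠ ⊤ := by
        intro hut
        rw [if_pos hut] at h
        exact not_top_lt h
      rw [if_neg hut] at h
      have hut' : (u x : EReal) ≠ ⊤ := by simpa using hut
      have hub : (u x : EReal) ≠ ⊥ := by simp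
      have key : ∃ q : ℚ, (u x : EReal) < ((q : ℝ) : EReal) ∧
          ((q : ℝ) : EReal) - (w x : EReal) < t := by
        by_cases hwt : w x = ⊤
        · obtain ⟨q, h1, -⟩ := EReal.lt_iff_exists_rat_btwn.1 (lt_top_iff_ne_top.2 hut')
          refine ⟨q, h1, ?_⟩
          rw [hwt] at h ⊢
          simpa using h
        · have hwt' : (w x : EReal) ≠ ⊤ := by simpa using hwt
          have hwb : (w x : EReal) ≠ ⊥ := by simp
          rw [EReal.sub_lt_iff (Or.inl hwb) (Or.inl hwt')] at h
          obtain ⟨q, h1, h2⟩ := EReal.lt_iff_exists_rat_btwn.1 h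
          exact ⟨q, h1, (EReal.sub_lt_iff (Or.inl hwb) (Or.inl hwt')).2 h2⟩
      obtain ⟨q, h1, h2⟩ := key
      have hq : (0 : ℝ) ≤ q := by
        have : (0 : EReal) < ((q : ℝ) : EReal) := lt_of_le_of_lt (EReal.coe_ennreal_nonneg _) h1
        exact_mod_cast this.le
      have hqe : ((ENNReal.ofReal q : ℝ≥0∞) : EReal) = ((q : ℝ) : EReal) := by
        rw [EReal.coe_ennreal_ofReal, max_eq_left hq]
      refine ⟨q, ?_, by rwa [hqe]⟩
      rwa [← EReal.coe_ennreal_lt_coe_ennreal_iff, hqe]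
    · rintro ⟨q, h1, h2⟩
      rw [if_neg h1.ne_top]
      exact (EReal.sub_le_sub (EReal.coe_ennreal_le_coe_ennreal_iff.2 h1.le) le_rfl).trans_lt h2
  rw [this]
  exact AnalyticSet.iUnion fun q => (hu.lt _).inter
    ((hw.comp_antitone (φ := fun y : ℝ≥0∞ => ((ENNReal.ofReal q : ℝ≥0∞) : EReal) - (y : EReal))
      fun _ _ h => EReal.sub_le_sub le_rfl (EReal.coe_ennreal_le_coe_ennreal_iff.2 h)).lt t)

theorem monotone_ePos : Monotone ePos := by
  intro y y' h
  unfold ePos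
  split_ifs with h1 h2 h2
  · exact le_rfl
  · exact absurd (top_le_iff.1 (h1 ▸ h)) h2
  · exact le_top
  · rcases eq_or_ne y ⊥ with rfl | hb
    · simp
    · exact ENNReal.ofReal_le_ofReal (EReal.toReal_le_toReal h hb h2)

theorem antitone_ePos_neg : Antitone fun y : EReal => ePos (-y) :=
  fun _ _ h => monotone_ePos (EReal.neg_le_neg_iff.2 h)

theorem monotone_avg (n : ℕ) : Monotone (avg n) := fun _ _ h => by
  unfold avg
  gcongr

theorem LSA.esum {n : ℕ} {v : Fin n → γ → EReal} (hv : ∀ i, LSA (v i)) :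
    LSA fun x => PaperStmt.esum fun i => v i x :=
  LSA.ediff (LSA.sum_ennreal _ fun i => (hv i).comp_monotone monotone_ePos)
    (USA.sum_ennreal _ fun i => (hv i).comp_antitone antitone_ePos_neg)

end Semianalytic

/-! ### Semianalyticity of measures of analytic sets and of integrals -/

section Integrals

variable {α : Type*} [TopologicalSpace α] [PolishSpace α] [MeasurableSpace α] [BorelSpace α]

theorem measurable_measure_closure_image_dominatedUpTo (f : (ℕ → ℕ) → α) (m : ℕ) :
    Measurable fun z : ProbabilityMeasure α × (ℕ → ℕ) =>
      z.1.toMeasure (closure (f '' dominatedUpTo z.2 m)) := by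
  let ext0 : (Fin m → ℕ) → ℕ → ℕ := fun u i => if h : i < m then u ⟨i, h⟩ else 0
  have h1 : Measurable fun z : ProbabilityMeasure α × (Fin m → ℕ) =>
      z.1.toMeasure (closure (f '' dominatedUpTo (ext0 z.2) m)) :=
    measurable_from_prod_countable_left fun u =>
      measurable_prob_apply (s := closure (f '' dominatedUpTo (ext0 u) m))
        isClosed_closure.measurableSet
  have h2 : Measurable fun z : ProbabilityMeasure α × (ℕ → ℕ) =>
      ((z.1, fun i : Fin m => z.2 i) : ProbabilityMeasure α × (Fin m → ℕ)) := by fun_prop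
  convert h1.comp h2 using 2 with z
  have : dominatedUpTo z.2 m = dominatedUpTo (ext0 fun i : Fin m => z.2 i) m := by
    ext x
    refine forall₂_congr fun i hi => ?_
    simp [ext0, hi]
  simp [this]

theorem usa_measure {S : Set α} (hS : AnalyticSet S) :
    USA fun p : ProbabilityMeasure α => p.toMeasure S := by
  rw [AnalyticSet] at hS
  rcases hS with rfl | ⟨f, hf, rfl⟩
  · simp only [measure_empty]
    exact USA.const_usa 0
  refine USA.of_lt fun t => ?_
  have : {p : ProbabilityMeasure α | t < p.toMeasure (Set.range f)} =
      ⋃ n : {n // t < TopologicalSpace.denseSeq ℝ≥0∞ n}, Prod.fst ''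
        {z : ProbabilityMeasure α × (ℕ → ℕ) | ∀ m, TopologicalSpace.denseSeq ℝ≥0∞ n ≤
          z.1.toMeasure (closure (f '' dominatedUpTo z.2 m))} := by
    ext p
    simp only [Set.mem_ofPred_eq, Set.mem_iUnion, Set.mem_image, Prod.exists,
      exists_and_right, exists_eq_right]
    constructor
    · intro h
      obtain ⟨n, h1, h2⟩ := exists_denseSeq_btwn h
      obtain ⟨b, hb⟩ := exists_dominatedUpTo_lt_measure p.toMeasure f h2
      exact ⟨⟨n, h1⟩, b, fun m => (hb m).le.trans (measure_mono subset_closure)⟩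
    · rintro ⟨⟨n, hn⟩, b, hb⟩
      exact hn.trans_le ((le_measure_image_dominated p.toMeasure hf hb).trans
        (measure_mono (Set.image_subset_range _ _)))
  rw [this]
  refine AnalyticSet.iUnion fun n => ?_
  refine MeasurableSet.analyticSet_image ?_ measurable_fst
  simp only [Set.ofPred_forall]
  exact MeasurableSet.iInter fun m =>
    measurableSet_le measurable_const (measurable_measure_closure_image_dominatedUpTo f m)

theorem analyticSet_exists_map_fst {β : Type*} [TopologicalSpace β] [PolishSpace β]
    [MeasurableSpace β] [BorelSpace β] {B : Set (ProbabilityMeasure (α × β))} (hB : AnalyticSet B) :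
    AnalyticSet {p : ProbabilityMeasure α | ∃ ρ ∈ B, ρ.toMeasure.map Prod.fst = p.toMeasure} := by
  have := hB.image_of_continuous (ProbabilityMeasure.continuous_map (f := Prod.fst) continuous_fst)
  convert this using 1
  ext p
  simp only [Set.mem_ofPred_eq, Set.mem_image]
  refine exists_congr fun ρ => and_congr_right fun _ => ?_
  exact ⟨fun h => Subtype.ext h, fun h => congrArg Subtype.val h⟩

theorem measurable_lintegral_snd :
    Measurable fun ρ : ProbabilityMeasure (α × ℝ≥0∞) => ∫⁻ z, z.2 ∂ρ.toMeasure :=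
  (Measure.measurable_lintegral measurable_snd).comp measurable_toMeasure

theorem exists_graph_measure {h : α → ℝ≥0∞} (hh : Measurable[umSpace α] h) {T : Set (α × ℝ≥0∞)}
    (hT : AnalyticSet T) (hTh : ∀ x, (x, h x) ∈ T) (p : ProbabilityMeasure α) :
    ∃ ρ : ProbabilityMeasure (α × ℝ≥0∞), 1 ≤ ρ.toMeasure T ∧
      ∫⁻ z, z.2 ∂ρ.toMeasure = ∫⁻ x, h x ∂p.toMeasure ∧
      ρ.toMeasure.map Prod.fst = p.toMeasure := by
  have hae : AEMeasurable h p.toMeasure := aemeasurable_of_umSpace hh _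
  have hg : AEMeasurable (fun x => (x, h x)) p.toMeasure := aemeasurable_id.prodMk hae
  have hprob := Measure.isProbabilityMeasure_map hg
  refine ⟨⟨p.toMeasure.map fun x => (x, h x), hprob⟩, ?_, ?_, ?_⟩
  · change 1 ≤ (p.toMeasure.map fun x => (x, h x)) T
    rw [Measure.map_apply₀ hg (hT.nullMeasurableSet _)]
    have : (fun x => (x, h x)) ⁻¹' T = Set.univ := Set.eq_univ_of_forall hTh
    simp [this]
  · change ∫⁻ z, z.2 ∂(p.toMeasure.map fun x => (x, h x)) = _
    rw [lintegral_map' measurable_snd.aemeasurable hg]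
  · change (p.toMeasure.map fun x => (x, h x)).map Prod.fst = _
    rw [AEMeasurable.map_map_of_aemeasurable measurable_fst.aemeasurable hg]
    exact Measure.map_id

theorem ae_mem_of_one_le {γ : Type*} [TopologicalSpace γ] [T2Space γ] [MeasurableSpace γ]
    [OpensMeasurableSpace γ] {μ : Measure γ} [IsProbabilityMeasure μ] {T : Set γ}
    (hT : AnalyticSet T) (h : 1 ≤ μ T) : ∀ᵐ z ∂μ, z ∈ T :=
  (mem_ae_iff_prob_eq_one₀ (hT.nullMeasurableSet μ)).2 (le_antisymm prob_le_one h)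

theorem USA.lintegral {h : α → ℝ≥0∞} (hh : USA h) :
    USA fun p : ProbabilityMeasure α => ∫⁻ x, h x ∂p.toMeasure := by
  have hm : Measurable[umSpace α] h := hh.measurable_umSpace
  let T : Set (α × ℝ≥0∞) := {z | z.2 ≤ h z.1}
  have hT : AnalyticSet T := hh.analyticSet_hypograph
  refine USA.of_lt fun t => ?_
  convert analyticSet_exists_map_fst (((usa_measure hT).le 1).inter
    (measurableSet_lt measurable_const measurable_lintegral_snd).analyticSet' :
      AnalyticSet ({ρ | (1 : ℝ≥0∞) ≤ ρ.toMeasure T} ∩ {ρ | t < ∫⁻ z, z.2 ∂ρ.toMeasure})) using 1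
  ext p
  simp only [Set.mem_ofPred_eq, Set.mem_inter_iff]
  constructor
  · intro hp
    obtain ⟨ρ, h1, h2, h3⟩ := exists_graph_measure hm hT (fun x => le_refl (h x)) p
    exact ⟨ρ, ⟨h1, h2 ▸ hp⟩, h3⟩
  · rintro ⟨ρ, ⟨h1, h2⟩, h3⟩
    refine h2.trans_le ?_
    rw [← h3, lintegral_map' (h3 ▸ aemeasurable_of_umSpace hm _) measurable_fst.aemeasurable]
    exact lintegral_mono_ae (ae_mem_of_one_le hT h1)

theorem LSA.lintegral {h : α → ℝ≥0∞} (hh : LSA h) :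
    LSA fun p : ProbabilityMeasure α => ∫⁻ x, h x ∂p.toMeasure := by
  have hm : Measurable[umSpace α] h := hh.measurable_umSpace
  let T : Set (α × ℝ≥0∞) := {z | h z.1 ≤ z.2}
  have hT : AnalyticSet T := hh.analyticSet_epigraph
  refine LSA.of_lt fun t => ?_
  convert analyticSet_exists_map_fst (((usa_measure hT).le 1).inter
    (measurableSet_lt measurable_lintegral_snd measurable_const).analyticSet' :
      AnalyticSet ({ρ | (1 : ℝ≥0∞) ≤ ρ.toMeasure T} ∩ {ρ | ∫⁻ z, z.2 ∂ρ.toMeasure < t})) using 1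
  ext p
  simp only [Set.mem_ofPred_eq, Set.mem_inter_iff]
  constructor
  · intro hp
    obtain ⟨ρ, h1, h2, h3⟩ := exists_graph_measure hm hT (fun x => le_refl (h x)) p
    exact ⟨ρ, ⟨h1, h2 ▸ hp⟩, h3⟩
  · rintro ⟨ρ, ⟨h1, h2⟩, h3⟩
    refine lt_of_le_of_lt ?_ h2
    rw [← h3, lintegral_map' (h3 ▸ aemeasurable_of_umSpace hm _) measurable_fst.aemeasurable]
    exact lintegral_mono_ae (ae_mem_of_one_le hT h1)

theorem LSA.eint {h : α → EReal} (hh : LSA h) :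
    LSA fun p : ProbabilityMeasure α => PaperStmt.eint p.toMeasure h :=
  LSA.ediff (hh.comp_monotone monotone_ePos).lintegral
    (hh.comp_antitone antitone_ePos_neg).lintegral

end Integrals

/-! ### Semianalyticity of the cost criteria -/

section Criteria

variable {X Z A : Type*} [TopologicalSpace X] [PolishSpace X] [MeasurableSpace X] [BorelSpace X]
  [TopologicalSpace Z] [PolishSpace Z] [MeasurableSpace Z] [BorelSpace Z]
  [TopologicalSpace A] [PolishSpace A] [MeasurableSpace A] [BorelSpace A] {c : X × A → EReal}

theorem LSA.pathSumO (hc : LSA c) (n j : ℕ) :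
    LSA (PaperStmt.pathSumO c n j : TrajO X Z A → EReal) :=
  LSA.esum fun k => hc.comp_measurable (u := fun ω : TrajO X Z A =>
    ((ω (k.val + j)).1, (ω (k.val + j)).2.2)) (by fun_prop)

theorem LSA.avg {γ : Type*} [TopologicalSpace γ] {f : γ → EReal} (hf : LSA f) (n : ℕ) :
    LSA fun x => PaperStmt.avg n (f x) :=
  hf.comp_monotone (monotone_avg n)

theorem LSA.cbarO (hc : LSA c) : LSA (PaperStmt.cbarO c : TrajO X Z A → EReal) :=
  LSA.limsup fun n => (hc.pathSumO n 0).avg n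

theorem LSA.J1O (hc : LSA c) : LSA (PaperStmt.J1O (Z := Z) c) :=
  LSA.limsup fun n => (hc.pathSumO n 0).eint.avg n

theorem LSA.J2O (hc : LSA c) : LSA (PaperStmt.J2O (Z := Z) c) :=
  LSA.liminf fun n => (hc.pathSumO n 0).eint.avg n

theorem LSA.J3O (hc : LSA c) : LSA (PaperStmt.J3O (Z := Z) c) :=
  LSA.limsup fun n => LSA.iSup fun j => (hc.pathSumO n j).eint.avg n

theorem LSA.J4O (hc : LSA c) : LSA (PaperStmt.J4O (Z := Z) c) :=
  LSA.liminf fun n => LSA.iInf fun j => (hc.pathSumO n j).eint.avg n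

theorem LSA.Jt1O (hc : LSA c) : LSA (PaperStmt.Jt1O (Z := Z) c) :=
  LSA.eint (LSA.limsup fun n => (hc.pathSumO n 0).avg n)

theorem LSA.Jt2O (hc : LSA c) : LSA (PaperStmt.Jt2O (Z := Z) c) :=
  LSA.eint (LSA.liminf fun n => (hc.pathSumO n 0).avg n)

theorem LSA.Jt3O (hc : LSA c) : LSA (PaperStmt.Jt3O (Z := Z) c) :=
  LSA.eint (LSA.limsup fun n => LSA.iSup fun j => (hc.pathSumO n j).avg n)

theorem LSA.Jt4O (hc : LSA c) : LSA (PaperStmt.Jt4O (Z := Z) c) :=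
  LSA.eint (LSA.liminf fun n => LSA.iInf fun j => (hc.pathSumO n j).avg n)

theorem LSA.JpsiO (hc : LSA c) {ψ : EReal → ℝ≥0∞} {ψinv : ℝ≥0∞ → EReal} (hψ : Monotone ψ)
    (hψinv : Monotone ψinv) : LSA (PaperStmt.JpsiO (Z := Z) c ψ ψinv) :=
  LSA.limsup fun n => (((hc.pathSumO n 0).comp_monotone hψ).lintegral.comp_monotone hψinv).avg n

theorem LSA.JpsiHatO (hc : LSA c) {ψ : EReal → ℝ≥0∞} {ψinv : ℝ≥0∞ → EReal} (hψ : Monotone ψ)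
    (hψinv : Monotone ψinv) : LSA (PaperStmt.JpsiHatO (Z := Z) c ψ ψinv) :=
  LSA.limsup fun n => LSA.iSup fun j =>
    (((hc.pathSumO n j).comp_monotone hψ).lintegral.comp_monotone hψinv).avg n

theorem iInf_real_eq_iInf_rat {G : ℝ → EReal} (hG : Antitone G) :
    ⨅ z : ℝ, ((z : EReal) + G z) = ⨅ z : ℚ, (((z : ℝ) : EReal) + G z) := by
  refine le_antisymm (le_iInf fun z => iInf_le _ (z : ℝ)) (le_of_forall_gt fun t ht => ?_)
  obtain ⟨z, hz⟩ := iInf_lt_iff.1 ht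
  suffices ∃ r : ℚ, z ≤ r ∧ ((r : ℝ) : EReal) + G z < t by
    obtain ⟨r, hr, hrt⟩ := this
    exact (iInf_le _ r).trans_lt ((add_le_add le_rfl (hG hr)).trans_lt hrt)
  by_cases hb : G z = ⊥
  · obtain ⟨r, hr⟩ := exists_rat_gt z
    refine ⟨r, hr.le, ?_⟩
    rw [hb, EReal.add_bot] at hz ⊢
    exact hz
  have htop : G z ≠ ⊤ := by
    intro h
    rw [h, EReal.coe_add_top] at hz
    exact not_top_lt hz
  obtain ⟨r, h1, h2⟩ := EReal.lt_iff_exists_rat_btwn.1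
    ((EReal.lt_sub_iff_add_lt (Or.inl hb) (Or.inl htop)).2 hz)
  exact ⟨r, by exact_mod_cast h1.le, (EReal.lt_sub_iff_add_lt (Or.inl hb) (Or.inl htop)).1 h2⟩

theorem LSA.RcvarO (hc : LSA c) (α : ℝ) : LSA (PaperStmt.RcvarO (Z := Z) c α) := by
  have hmono : ∀ z : EReal, Monotone fun y : EReal => ePos (y - z) := fun z _ _ h =>
    monotone_ePos (EReal.sub_le_sub h le_rfl)
  have heq : ∀ p : ProbabilityMeasure (TrajO X Z A), PaperStmt.RcvarO c α p =
      ⨅ z : ℚ, (((z : ℝ) : EReal) + (((ENNReal.ofReal α)⁻¹ *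
        ∫⁻ ω, ePos (PaperStmt.cbarO c ω - ((z : ℝ) : EReal)) ∂p.toMeasure : ℝ≥0∞) : EReal)) :=
    fun p => iInf_real_eq_iInf_rat (G := fun z : ℝ => (((ENNReal.ofReal α)⁻¹ *
        ∫⁻ ω, ePos (PaperStmt.cbarO c ω - (z : EReal)) ∂p.toMeasure : ℝ≥0∞) : EReal))
      fun z z' h => EReal.coe_ennreal_le_coe_ennreal_iff.2 (mul_le_mul_right
        (lintegral_mono fun ω => monotone_ePos
          (EReal.sub_le_sub le_rfl (EReal.coe_le_coe_iff.2 h))) _)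
  rw [funext heq]
  refine LSA.iInf fun z => (hc.cbarO.comp_monotone (hmono _)).lintegral.comp_monotone
    (φ := fun y : ℝ≥0∞ => ((z : ℝ) : EReal) + (((ENNReal.ofReal α)⁻¹ * y : ℝ≥0∞) : EReal))
    fun y y' h => add_le_add le_rfl (EReal.coe_ennreal_le_coe_ennreal_iff.2 (mul_le_mul_right h _))

theorem LSA.RvarO (hc : LSA c) (α : ℝ) : LSA (PaperStmt.RvarO (Z := Z) c α) := by
  refine LSA.of_lt fun t => ?_
  have : {p : ProbabilityMeasure (TrajO X Z A) | PaperStmt.RvarO c α p < t} =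
      ⋃ z : {z : ℚ // ((z : ℝ) : EReal) < t}, {p | 1 - ENNReal.ofReal α ≤
        p.toMeasure {ω | PaperStmt.cbarO c ω ≤ ((z : ℝ) : EReal)}} := by
    ext p
    simp only [PaperStmt.RvarO, Set.mem_ofPred_eq, iInf_lt_iff, Set.mem_iUnion]
    constructor
    · rintro ⟨z, hz, hzt⟩
      obtain ⟨r, h1, h2⟩ := EReal.lt_iff_exists_rat_btwn.1 hzt
      exact ⟨⟨r, h2⟩, hz.trans (measure_mono fun ω hω => le_trans hω h1.le)⟩
    · rintro ⟨⟨r, hr⟩, h⟩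
      exact ⟨r, h, hr⟩
  rw [this]
  exact AnalyticSet.iUnion fun z => (usa_measure (hc.cbarO.le _)).le _

end Criteria

/-! ### Partial minimization with measurable selection -/

section Selection

variable {Y W : Type*} [TopologicalSpace Y] [T2Space Y] [SecondCountableTopology Y]
  [MeasurableSpace Y] [BorelSpace Y] [StandardBorelSpace Y]
  [TopologicalSpace W] [T2Space W] [SecondCountableTopology W]
  [MeasurableSpace W] [BorelSpace W] [StandardBorelSpace W]

/-- The infimum of `J` over the part of `S` in the fibre of `mg` over `y`. -/
def fibreInf (S : Set W) (mg : W → Y) (J : W → EReal) (y : Y) : EReal :=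
  ⨅ (w : W) (_ : w ∈ S ∧ mg w = y), J w

theorem LSA.fibreInf {S : Set W} (hS : AnalyticSet S) {mg : W → Y} (hmg : Continuous mg)
    {J : W → EReal} (hJ : LSA J) : LSA (PaperStmt.fibreInf S mg J) := by
  refine LSA.of_lt fun t => ?_
  convert (hS.inter (hJ.lt t)).image_of_continuous hmg using 1
  ext y
  simp only [PaperStmt.fibreInf, iInf_lt_iff, Set.mem_ofPred_eq, Set.mem_image, Set.mem_inter_iff]
  exact exists_congr fun w => ⟨fun ⟨⟨h1, h2⟩, h3⟩ => ⟨⟨h1, h3⟩, h2⟩,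
    fun ⟨⟨h1, h3⟩, h2⟩ => ⟨⟨h1, h2⟩, h3⟩⟩

theorem exists_measurable_nearMinimizer {S : Set W} (hS : AnalyticSet S) {mg : W → Y}
    (hmg : Continuous mg) (hsurj : ∀ y, ∃ w ∈ S, mg w = y) {J : W → EReal} (hJ : LSA J)
    [Nonempty W] {ε : ℝ} (hε : 0 < ε) :
    ∃ R : Y → W, Measurable[umSpace Y] R ∧ ∀ y, R y ∈ S ∧ mg (R y) = y ∧
      (fibreInf S mg J y ≠ ⊥ → J (R y) ≤ fibreInf S mg J y + (ε : EReal)) ∧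
      (fibreInf S mg J y = ⊥ → J (R y) ≤ ((-ε⁻¹ : ℝ) : EReal)) ∧
      ((∃ w ∈ S, mg w = y ∧ J w = fibreInf S mg J y) → J (R y) = fibreInf S mg J y) := by
  classical
  set g := fibreInf S mg J with hg
  have hgm : Measurable[umSpace Y] g := (LSA.fibreInf hS hmg hJ).measurable_umSpace
  let G : Set ((Y × EReal) × W) := {z | (z.2 ∈ S ∧ mg z.2 = z.1.1) ∧ J z.2 ≤ z.1.2}
  have hG : AnalyticSet G :=
    ((hS.preimage_measurable measurable_snd).inter
      (measurableSet_eq_fun (hmg.measurable.comp measurable_snd)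
        (measurable_fst.comp measurable_fst)).analyticSet').inter
      (hJ.analyticSet_epigraph.preimage_measurable
        (measurable_snd.prodMk (measurable_snd.comp measurable_fst)))
  obtain ⟨φ, hφ, hφG⟩ := exists_selection hG
  let E : Set Y := {y | (y, g y) ∈ Prod.fst '' G}
  have hgraph : Measurable[umSpace Y] fun y => (y, g y) :=
    Measurable.prodMk (m := umSpace Y) measurable_id.universallyMeasurable hgm
  have hE : MeasurableSet[umSpace Y] E :=
    measurable_umSpace_umSpace hgraph
      (hG.image_of_continuous continuous_fst).measurableSet_umSpace
  let relax : EReal → EReal := fun v => if v = ⊥ then ((-ε⁻¹ : ℝ) : EReal) else v + (ε : EReal)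
  have hrelax : Measurable relax :=
    Measurable.ite (measurableSet_singleton _) measurable_const (measurable_id.add_const _)
  let τ : Y → EReal := fun y => if y ∈ E then g y else relax (g y)
  have hτ : Measurable[umSpace Y] τ :=
    Measurable.ite (m := umSpace Y) hE hgm (hrelax.comp hgm)
  have hτ' : Measurable[umSpace Y] fun y => (y, τ y) :=
    Measurable.prodMk (m := umSpace Y) measurable_id.universallyMeasurable hτ
  have hex : ∀ y, ∃ w, ((y, τ y), w) ∈ G := by
    intro y
    by_cases hy : y ∈ E
    · obtain ⟨⟨z, w⟩, hz, rfl⟩ := id hy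
      refine ⟨w, ?_⟩
      simpa only [τ, if_pos hy] using hz
    · have hlt : g y = ⊤ ∨ g y < τ y := by
        simp only [τ, if_neg hy, relax]
        split_ifs with hb
        · exact Or.inr (hb ▸ EReal.bot_lt_coe _)
        · refine or_iff_not_imp_left.2 fun ht => ?_
          lift g y to ℝ using ⟨ht, hb⟩ with r
          exact_mod_cast lt_add_of_pos_right r hε
      rcases hlt with htop | hlt
      · obtain ⟨w, hw, hwy⟩ := hsurj y
        refine ⟨w, ⟨hw, hwy⟩, ?_⟩
        have : τ y = ⊤ := by simp [τ, if_neg hy, relax, htop]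
        simp [this]
      · obtain ⟨w, hw, hwt⟩ := by simpa only [hg, fibreInf, iInf_lt_iff] using hlt
        exact ⟨w, hw, hwt.le⟩
  refine ⟨fun y => φ (y, τ y), hφ.comp (measurable_umSpace_umSpace hτ'), fun y => ?_⟩
  obtain ⟨w, hw⟩ := hex y
  obtain ⟨⟨h1, h2⟩, h3⟩ := hφG _ _ hw
  have hge : g y ≤ J (φ (y, τ y)) := iInf₂_le _ ⟨h1, h2⟩
  refine ⟨h1, h2, fun hb => h3.trans ?_, fun hb => h3.trans ?_, fun ⟨w', hw', hwy, hwJ⟩ => ?_⟩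
  · simp only [τ, relax, if_neg hb]
    split_ifs
    · exact le_add_of_nonneg_right (by exact_mod_cast hε.le)
    · exact le_rfl
  · simp only [τ, relax, if_pos hb]
    split_ifs
    · exact hb ▸ bot_le
    · exact le_rfl
  · have hyE : y ∈ E := ⟨((y, g y), w'), ⟨⟨hw', hwy⟩, hwJ.le⟩, rfl⟩
    have hτg : τ y = g y := if_pos hyE
    exact le_antisymm (h3.trans hτg.le) hge

end Selection

/-! ### Measurable disintegration -/

section Disintegration

variable {I A : Type*} [TopologicalSpace I] [PolishSpace I] [MeasurableSpace I] [BorelSpace I]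
  [TopologicalSpace A] [PolishSpace A] [MeasurableSpace A] [BorelSpace A]

/-- The kernel sending a probability measure to itself. -/
def evalKernel (α : Type*) [TopologicalSpace α] [PolishSpace α] [MeasurableSpace α]
    [BorelSpace α] : Kernel (ProbabilityMeasure α) α :=
  ⟨fun p => p.toMeasure, measurable_toMeasure⟩

theorem evalKernel_apply (p : ProbabilityMeasure A) : evalKernel A p = p.toMeasure := rfl

instance instMarkovEvalKernel : IsMarkovKernel (evalKernel A) :=
  ⟨fun p => inferInstanceAs (IsProbabilityMeasure p.toMeasure)⟩

variable [Nonempty A]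

/-- The conditional distribution of the second coordinate given the first one, jointly measurable
in the measure and the first coordinate. -/
def condDist (z : ProbabilityMeasure (I × A) × I) : ProbabilityMeasure A :=
  ⟨(evalKernel (I × A)).condKernel z, inferInstance⟩

theorem measurable_condDist : Measurable (condDist : ProbabilityMeasure (I × A) × I → _) :=
  measurable_prob_iff_measure.2 (evalKernel (I × A)).condKernel.measurable

theorem lintegral_condDist (ρ : ProbabilityMeasure (I × A)) {f : I × A → ℝ≥0∞}
    (hf : Measurable f) :
    ∫⁻ z, f z ∂ρ.toMeasure =
      ∫⁻ i, ∫⁻ a, f (i, a) ∂(condDist (ρ, i)).toMeasure ∂(ρ.toMeasure.map Prod.fst) := by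
  have h := (evalKernel (I × A)).disintegrate (evalKernel (I × A)).condKernel
  conv_lhs => rw [← evalKernel_apply ρ, ← h, Kernel.lintegral_compProd _ _ _ hf]
  rw [Kernel.fst_apply]
  rfl

theorem condDist_ae_eq (ρ : ProbabilityMeasure (I × A)) {ν : I → ProbabilityMeasure A}
    (hν : AEMeasurable ν (ρ.toMeasure.map Prod.fst))
    (h : ∀ s, MeasurableSet s →
      ρ.toMeasure s = ∫⁻ i, (ν i).toMeasure (Prod.mk i ⁻¹' s) ∂(ρ.toMeasure.map Prod.fst)) :
    (fun i => condDist (ρ, i)) =ᵐ[ρ.toMeasure.map Prod.fst] ν := by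
  let ν' : Kernel I A :=
    ⟨fun i => (hν.mk ν i).toMeasure, measurable_toMeasure.comp hν.measurable_mk⟩
  have hν' : IsMarkovKernel ν' :=
    ⟨fun i => inferInstanceAs (IsProbabilityMeasure (hν.mk ν i).toMeasure)⟩
  have hdis : ρ.toMeasure = ρ.toMeasure.fst ⊗ₘ ν' := by
    ext s hs
    rw [Measure.compProd_apply hs, h s hs]
    refine lintegral_congr_ae ?_
    filter_upwards [hν.ae_eq_mk] with i hi
    rw [hi]
    rfl
  have h1 := eq_condKernel_of_measure_eq_compProd ν' hdis
  have h2 := Kernel.condKernel_apply_eq_condKernel (evalKernel (I × A)) ρ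
  rw [Kernel.fst_apply] at h2
  filter_upwards [h1, h2, hν.ae_eq_mk] with i hi1 hi2 hi3
  refine Subtype.ext (hi2.trans (hi1.symm.trans ?_))
  rw [hi3]
  rfl

end Disintegration

/-! ### Laws of histories -/

section Histories

variable {X Z A : Type*} [TopologicalSpace X] [PolishSpace X] [MeasurableSpace X] [BorelSpace X]
  [TopologicalSpace Z] [PolishSpace Z] [MeasurableSpace Z] [BorelSpace Z]
  [TopologicalSpace A] [PolishSpace A] [MeasurableSpace A] [BorelSpace A]

theorem measurable_infoOf {F : X → Z} (hF : Measurable F) (n : ℕ) :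
    Measurable (infoOf F : HistO X Z A n → Info Z A n) :=
  (measurable_pi_lambda _ fun k => by fun_prop).prodMk (by fun_prop)

/-- Extension of a history by one stage. -/
def extendHist (F : X → Z) {n : ℕ} (h : HistO X Z A n) (a : A) (y : X) : HistO X Z A (n + 1) :=
  (Fin.snoc h.1 (h.2, F h.2, a), y)

theorem measurable_extendHist {F : X → Z} (hF : Measurable F) (n : ℕ) :
    Measurable fun w : HistO X Z A n × A × X => extendHist F w.1 w.2.1 w.2.2 := by
  refine Measurable.prodMk (measurable_pi_lambda _ fun k => ?_) (by fun_prop)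
  refine Fin.lastCases ?_ (fun j => ?_) k
  · simp only [Fin.snoc_last]
    fun_prop
  · simp only [Fin.snoc_castSucc]
    fun_prop

/-- The law of the history after one further stage, given the current history and the law of the
current action. -/
def stepKernel (q : Kernel (X × A) X) (F : X → Z) (n : ℕ) :
    Kernel (HistO X Z A n × ProbabilityMeasure A) (HistO X Z A (n + 1)) :=
  ((Kernel.deterministic (Prod.fst : HistO X Z A n × ProbabilityMeasure A → _) measurable_fst) ×ₖ
    ((evalKernel A).comap Prod.snd measurable_snd ⊗ₖ
      q.comap (fun w : (HistO X Z A n × ProbabilityMeasure A) × A => (w.1.1.2, w.2))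
        (by fun_prop))).map fun w => extendHist F w.1 w.2.1 w.2.2

variable {q : Kernel (X × A) X} [IsMarkovKernel q] {F : X → Z}

theorem isMarkovKernel_stepKernel (hF : Measurable F) (n : ℕ) :
    IsMarkovKernel (stepKernel q F n : Kernel (HistO X Z A n × ProbabilityMeasure A) _) :=
  Kernel.IsMarkovKernel.map _ (measurable_extendHist hF n)

theorem lintegral_stepKernel (hF : Measurable F) {n : ℕ} (h : HistO X Z A n)
    (κ : ProbabilityMeasure A) {g : HistO X Z A (n + 1) → ℝ≥0∞} (hg : Measurable g) :
    ∫⁻ w, g w ∂(stepKernel q F n (h, κ)) =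
      ∫⁻ a, ∫⁻ y, g (extendHist F h a y) ∂(q (h.2, a)) ∂κ.toMeasure := by
  have he := measurable_extendHist (A := A) hF n
  rw [stepKernel, Kernel.lintegral_map _ he _ hg, Kernel.lintegral_deterministic_prod,
    Kernel.lintegral_compProd]
  · rfl
  all_goals fun_prop

theorem ae_stepKernel (hF : Measurable F) {n : ℕ} {h : HistO X Z A n}
    {κ : ProbabilityMeasure A} {P : HistO X Z A (n + 1) → Prop}
    (hP : ∀ᵐ w ∂(stepKernel q F n (h, κ)), P w) :
    ∀ᵐ a ∂κ.toMeasure, ∀ᵐ y ∂(q (h.2, a)), P (extendHist F h a y) := by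
  obtain ⟨N, hN, hNm, hN0⟩ := exists_measurable_superset_of_null hP
  have he := measurable_extendHist (A := A) hF n
  have hind : Measurable (N.indicator (1 : HistO X Z A (n + 1) → ℝ≥0∞)) :=
    measurable_one.indicator hNm
  rw [← lintegral_indicator_one hNm, lintegral_stepKernel hF h κ hind,
    lintegral_eq_zero_iff] at hN0
  · filter_upwards [hN0] with a ha
    rw [Pi.zero_apply, lintegral_eq_zero_iff (by fun_prop)] at ha
    filter_upwards [ha] with y hy
    by_contra hcon
    simp [Set.indicator_of_mem (hN hcon)] at hy
  · have : Measurable fun z : A × X => N.indicator (1 : HistO X Z A (n + 1) → ℝ≥0∞)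
      (extendHist F h z.1 z.2) := by fun_prop
    exact this.lintegral_kernel_prod_right' (κ := q.comap (fun a => (h.2, a)) (by fun_prop))

/-- The law of the history at stage `n` when actions are chosen according to `κ`. -/
def histLaw (p0 : Measure X) (F : X → Z) (q : Kernel (X × A) X)
    (κ : ∀ n, Info Z A n → ProbabilityMeasure A) : ∀ n, Measure (HistO X Z A n)
  | 0 => p0.map fun x => (Fin.elim0, x)
  | n + 1 => (histLaw p0 F q κ n).bind fun h => stepKernel q F n (h, κ n (infoOf F h))

end Histories

section HistoryLaws

variable {X Z A : Type*} [TopologicalSpace X] [PolishSpace X] [MeasurableSpace X] [BorelSpace X]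
  [TopologicalSpace Z] [PolishSpace Z] [MeasurableSpace Z] [BorelSpace Z]
  [TopologicalSpace A] [PolishSpace A] [MeasurableSpace A] [BorelSpace A]
  {q : Kernel (X × A) X} [IsMarkovKernel q] {F : X → Z}
  {κ : ∀ n, Info Z A n → ProbabilityMeasure A}

theorem measurable_umSpace_prodMk_infoOf (hF : Measurable F) {n : ℕ}
    {ν : Info Z A n → ProbabilityMeasure A} (hν : Measurable[umSpace _] ν) :
    Measurable[umSpace (HistO X Z A n)] fun h => (h, ν (infoOf F h)) :=
  Measurable.prodMk (m := umSpace (HistO X Z A n)) measurable_id.universallyMeasurable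
    (hν.comp (measurable_umSpace_umSpace (measurable_infoOf hF n).universallyMeasurable))

theorem aemeasurable_step (hF : Measurable F) {n : ℕ} {ν : Info Z A n → ProbabilityMeasure A}
    (hν : Measurable[umSpace _] ν) (μ : Measure (HistO X Z A n)) [IsProbabilityMeasure μ] :
    AEMeasurable (fun h => stepKernel q F n (h, ν (infoOf F h))) μ :=
  (stepKernel q F n).measurable.comp_aemeasurable
    (aemeasurable_of_umSpace (measurable_umSpace_prodMk_infoOf hF hν) μ)

theorem isProbabilityMeasure_histLaw (hF : Measurable F) (hκ : ∀ n, Measurable[umSpace _] (κ n))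
    (p0 : Measure X) [IsProbabilityMeasure p0] (n : ℕ) :
    IsProbabilityMeasure (histLaw p0 F q κ n) := by
  induction n with
  | zero => exact Measure.isProbabilityMeasure_map (by fun_prop)
  | succ n ih =>
    have := isMarkovKernel_stepKernel (q := q) (A := A) hF n
    constructor
    rw [histLaw, Measure.bind_apply MeasurableSet.univ (aemeasurable_step hF (hκ n) _)]
    simp

theorem histIntO_eq_lintegral_histLaw (hF : Measurable F)
    (hκ : ∀ n, Measurable[umSpace _] (κ n)) (p0 : Measure X) [IsProbabilityMeasure p0] (n : ℕ)
    {g : HistO X Z A n → ℝ≥0∞} (hg : AEMeasurable g (histLaw p0 F q κ n)) :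
    histIntO p0 F q (fun n i => (κ n i).toMeasure) n g = ∫⁻ h, g h ∂(histLaw p0 F q κ n) := by
  induction n with
  | zero =>
    rw [histLaw, lintegral_map' hg (by fun_prop)]
    rfl
  | succ n ih =>
    have hprob := isProbabilityMeasure_histLaw (q := q) hF hκ p0 n
    have hstep := aemeasurable_step (q := q) hF (hκ n) (histLaw p0 F q κ n)
    have hae : (fun h => ∫⁻ a, ∫⁻ y, g (extendHist F h a y) ∂(q (h.2, a))
          ∂(κ n (infoOf F h)).toMeasure)
        =ᵐ[histLaw p0 F q κ n]
          fun h => ∫⁻ w, hg.mk g w ∂(stepKernel q F n (h, κ n (infoOf F h))) := by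
      filter_upwards [Measure.ae_ae_of_ae_bind hstep hg.ae_eq_mk] with h hh
      rw [lintegral_stepKernel hF _ _ hg.measurable_mk]
      refine lintegral_congr_ae ?_
      filter_upwards [ae_stepKernel hF hh] with a ha
      exact lintegral_congr_ae ha
    have hmeas : AEMeasurable (fun h => ∫⁻ w, hg.mk g w
        ∂(stepKernel q F n (h, κ n (infoOf F h)))) (histLaw p0 F q κ n) :=
      (Measure.measurable_lintegral hg.measurable_mk).comp_aemeasurable hstep
    refine (ih (hmeas.congr hae.symm)).trans ?_
    rw [lintegral_congr_ae hae, lintegral_congr_ae hg.ae_eq_mk]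
    exact (Measure.lintegral_bind hstep hg.measurable_mk.aemeasurable).symm

/-- The history along a trajectory. -/
def histOf (n : ℕ) (ω : TrajO X Z A) : HistO X Z A n := (fun i : Fin n => ω i.val, (ω n).1)

theorem measurable_histOf (n : ℕ) : Measurable (histOf n : TrajO X Z A → HistO X Z A n) := by
  unfold histOf
  fun_prop

/-- The action kernels of a policy as maps into the space of probability measures. -/
def PolicyI.prob {U : ∀ n : ℕ, Info Z A n → Set A} (π : PolicyI X U) (n : ℕ)
    (ip : Info Z A n × ProbabilityMeasure X) : ProbabilityMeasure A :=
  ⟨π.μ n ip, π.isProb n ip⟩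

theorem PolicyI.measurable_prob {U : ∀ n : ℕ, Info Z A n → Set A} (π : PolicyI X U) (n : ℕ) :
    Measurable[umSpace _] (π.prob n) :=
  measurable_prob_iff.2 fun s hs => π.umeas n s hs

theorem measurable_umSpace_section {I : Type*} [MeasurableSpace I] {Y V : Type*}
    [MeasurableSpace Y] [MeasurableSpace V] [MeasurableSpace.CountablyGenerated I]
    [MeasurableSpace.CountablyGenerated Y] {f : I × Y → V} (hf : Measurable[umSpace _] f) (y : Y) :
    Measurable[umSpace I] fun i => f (i, y) :=
  hf.comp (measurable_umSpace_umSpace measurable_prodMk_right.universallyMeasurable)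

theorem inducesI_iff_map_histOf {U : ∀ n : ℕ, Info Z A n → Set A} (hF : Measurable F)
    (π : PolicyI X U) (p0 : ProbabilityMeasure X) (p : Measure (TrajO X Z A)) :
    InducesI q F π p0 p ↔
      ∀ n, p.map (histOf n) = histLaw p0.toMeasure F q (fun n i => π.prob n (i, p0)) n := by
  have hκ : ∀ n, Measurable[umSpace _] fun i => π.prob n (i, p0) := fun n =>
    measurable_umSpace_section (π.measurable_prob n) p0
  refine forall_congr' fun n => ?_
  have hind : ∀ B : Set (HistO X Z A n), MeasurableSet B →
      histIntO p0.toMeasure F q (fun n i => π.μ n (i, p0)) n (B.indicator fun _ => 1) =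
        histLaw p0.toMeasure F q (fun n i => π.prob n (i, p0)) n B := fun B hB => by
    rw [← lintegral_indicator_one hB]
    exact histIntO_eq_lintegral_histLaw hF hκ p0.toMeasure n
      (measurable_one.indicator hB).aemeasurable
  constructor
  · intro h
    ext B hB
    rw [Measure.map_apply (measurable_histOf n) hB, ← hind B hB]
    exact h B hB
  · intro h B hB
    rw [hind B hB, ← h, Measure.map_apply (measurable_histOf n) hB]
    rfl

end HistoryLaws

section StrategicSet

variable {X Z A : Type*} [TopologicalSpace X] [PolishSpace X] [MeasurableSpace X] [BorelSpace X]
  [TopologicalSpace Z] [PolishSpace Z] [MeasurableSpace Z] [BorelSpace Z]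
  [TopologicalSpace A] [PolishSpace A] [MeasurableSpace A] [BorelSpace A]
  {q : Kernel (X × A) X} [IsMarkovKernel q] {F : X → Z}

/-- The pair of the information vector and the action at stage `n` along a trajectory. -/
def infoAct (F : X → Z) (n : ℕ) (ω : TrajO X Z A) : Info Z A n × A :=
  (infoOf F (histOf n ω), (ω n).2.2)

theorem measurable_infoAct (hF : Measurable F) (n : ℕ) :
    Measurable (infoAct F n : TrajO X Z A → Info Z A n × A) :=
  ((measurable_infoOf hF n).comp (measurable_histOf n)).prodMk (by fun_prop)

/-- The joint law of the information vector and the action at stage `n`. -/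
def infoActLaw (hF : Measurable F) (n : ℕ) (p : ProbabilityMeasure (TrajO X Z A)) :
    ProbabilityMeasure (Info Z A n × A) :=
  p.map (measurable_infoAct hF n).aemeasurable

theorem toMeasure_infoActLaw (hF : Measurable F) (n : ℕ) (p : ProbabilityMeasure (TrajO X Z A)) :
    (infoActLaw hF n p).toMeasure = p.toMeasure.map (infoAct F n) := rfl

theorem measurable_infoActLaw (hF : Measurable F) (n : ℕ) :
    Measurable (infoActLaw hF n : ProbabilityMeasure (TrajO X Z A) → _) := by
  refine measurable_prob_iff.2 fun s hs => ?_
  simp only [toMeasure_infoActLaw, Measure.map_apply (measurable_infoAct hF n) hs]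
  exact measurable_prob_apply (measurable_infoAct hF n hs)

theorem map_fst_infoActLaw (hF : Measurable F) (n : ℕ) (p : ProbabilityMeasure (TrajO X Z A)) :
    (infoActLaw hF n p).toMeasure.map Prod.fst = (p.toMeasure.map (histOf n)).map (infoOf F) := by
  rw [toMeasure_infoActLaw, Measure.map_map measurable_fst (measurable_infoAct hF n),
    Measure.map_map (measurable_infoOf hF n) (measurable_histOf n)]
  rfl

variable [Nonempty A]

/-- The conditional law of the action at stage `n` given the information vector. -/
def condAct (hF : Measurable F) (n : ℕ) (z : ProbabilityMeasure (TrajO X Z A) × Info Z A n) :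
    ProbabilityMeasure A :=
  condDist (infoActLaw hF n z.1, z.2)

theorem measurable_condAct (hF : Measurable F) (n : ℕ) :
    Measurable (condAct hF n : ProbabilityMeasure (TrajO X Z A) × Info Z A n → _) :=
  measurable_condDist.comp
    (((measurable_infoActLaw hF n).comp measurable_fst).prodMk measurable_snd)

/-- The trajectory laws whose conditional action laws depend on the information vector only,
respect the control constraints `U`, and almost surely belong to `D`. -/
def strategicSet (q : Kernel (X × A) X) (hF : Measurable F) (U : ∀ n : ℕ, Info Z A n → Set A)
    (D : Set (ProbabilityMeasure A)) : Set (ProbabilityMeasure (TrajO X Z A)) :=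
  {p | ∀ n, p.toMeasure.map (histOf (n + 1)) = (p.toMeasure.map (histOf n)).bind
        (fun h => stepKernel q F n (h, condAct hF n (p, infoOf F h))) ∧
      1 ≤ (infoActLaw hF n p).toMeasure {ia | ia.2 ∈ U n ia.1} ∧
      ∀ᵐ i ∂(infoActLaw hF n p).toMeasure.map Prod.fst, condAct hF n (p, i) ∈ D}

theorem measurable_prod_section {I B : Type*} [MeasurableSpace I] [TopologicalSpace B]
    [PolishSpace B] [MeasurableSpace B] [BorelSpace B] {s : Set (I × B)} (hs : MeasurableSet s) :
    Measurable fun z : I × ProbabilityMeasure B => z.2.toMeasure (Prod.mk z.1 ⁻¹' s) :=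
  Kernel.measurable_kernel_prodMk_left (κ := (evalKernel B).comap Prod.snd measurable_snd)
    (t := {w : (I × ProbabilityMeasure B) × B | (w.1.1, w.2) ∈ s})
    ((measurable_fst.fst.prodMk measurable_snd) hs)

theorem measurable_condStep (hF : Measurable F) (n : ℕ) :
    Measurable fun z : ProbabilityMeasure (TrajO X Z A) × HistO X Z A n =>
      stepKernel q F n (z.2, condAct hF n (z.1, infoOf F z.2)) :=
  (stepKernel q F n).measurable.comp (measurable_snd.prodMk ((measurable_condAct hF n).comp
    (measurable_fst.prodMk ((measurable_infoOf hF n).comp measurable_snd))))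

theorem measurableSet_map_histOf_eq (hF : Measurable F) (n : ℕ) :
    MeasurableSet {p : ProbabilityMeasure (TrajO X Z A) | p.toMeasure.map (histOf (n + 1)) =
      (p.toMeasure.map (histOf n)).bind
        (fun h => stepKernel q F n (h, condAct hF n (p, infoOf F h)))} := by
  have hM := isMarkovKernel_stepKernel (q := q) (A := A) hF n
  have hstep : ∀ p : ProbabilityMeasure (TrajO X Z A), Measurable fun h : HistO X Z A n =>
      stepKernel q F n (h, condAct hF n (p, infoOf F h)) := fun p =>
    (measurable_condStep hF n).comp measurable_prodMk_left
  have hprob : ∀ p : ProbabilityMeasure (TrajO X Z A), IsProbabilityMeasure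
      ((p.toMeasure.map (histOf n)).bind
        (fun h => stepKernel q F n (h, condAct hF n (p, infoOf F h)))) := fun p => by
    have := Measure.isProbabilityMeasure_map (μ := p.toMeasure)
      (measurable_histOf (X := X) (Z := Z) (A := A) n).aemeasurable
    constructor
    rw [Measure.bind_apply MeasurableSet.univ (hstep p).aemeasurable]
    simp
  let f : ProbabilityMeasure (TrajO X Z A) → ProbabilityMeasure (HistO X Z A (n + 1)) :=
    fun p => p.map (measurable_histOf (n + 1)).aemeasurable
  let g : ProbabilityMeasure (TrajO X Z A) → ProbabilityMeasure (HistO X Z A (n + 1)) :=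
    fun p => ⟨_, hprob p⟩
  have hf : Measurable f := by
    refine measurable_prob_iff.2 fun s hs => ?_
    simp only [f, ProbabilityMeasure.toMeasure_map, Measure.map_apply (measurable_histOf _) hs]
    exact measurable_prob_apply (measurable_histOf _ hs)
  have hg : Measurable g := by
    refine measurable_prob_iff.2 fun s hs => ?_
    have hgs : ∀ p, (g p).toMeasure s =
        ∫⁻ ω, stepKernel q F n (histOf n ω, condAct hF n (p, infoOf F (histOf n ω))) s
          ∂(evalKernel (TrajO X Z A) p) := fun p => by
      change ((p.toMeasure.map (histOf n)).bind _) s = _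
      rw [Measure.bind_apply hs (hstep p).aemeasurable]
      exact lintegral_map ((Measure.measurable_coe hs).comp (hstep p)) (measurable_histOf n)
    simp only [hgs]
    exact Measurable.lintegral_kernel_prod_right ((Measure.measurable_coe hs).comp
      ((measurable_condStep hF n).comp
        (measurable_fst.prodMk ((measurable_histOf n).comp measurable_snd))))
  convert measurableSet_eq_fun hf hg using 1
  ext p
  exact ⟨fun h => Subtype.ext h, fun h => congrArg ProbabilityMeasure.toMeasure h⟩

theorem analyticSet_strategicSet (hF : Measurable F) {U : ∀ n : ℕ, Info Z A n → Set A}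
    (hU : ∀ n : ℕ, AnalyticSet {ia : Info Z A n × A | ia.2 ∈ U n ia.1})
    {D : Set (ProbabilityMeasure A)} (hD : MeasurableSet D) :
    AnalyticSet (strategicSet q hF U D) := by
  simp only [strategicSet, Set.ofPred_forall]
  refine AnalyticSet.iInter fun n => ?_
  refine (measurableSet_map_histOf_eq hF n).analyticSet'.inter (AnalyticSet.inter ?_ ?_)
  · exact ((usa_measure (hU n)).le 1).preimage_measurable (measurable_infoActLaw hF n)
  · have hm : Measurable fun p : ProbabilityMeasure (TrajO X Z A) =>
        p.toMeasure {ω | condAct hF n (p, infoOf F (histOf n ω)) ∉ D} :=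
      Kernel.measurable_kernel_prodMk_left (κ := evalKernel (TrajO X Z A))
        (((measurable_condAct hF n).comp (measurable_fst.prodMk
          (((measurable_infoOf hF n).comp (measurable_histOf n)).comp measurable_snd))) hD.compl)
    have hio := (measurable_infoOf hF n).comp (measurable_histOf (X := X) (Z := Z) (A := A) n)
    have heq : {p : ProbabilityMeasure (TrajO X Z A) |
        ∀ᵐ i ∂(infoActLaw hF n p).toMeasure.map Prod.fst, condAct hF n (p, i) ∈ D} =
        {p | p.toMeasure {ω | condAct hF n (p, infoOf F (histOf n ω)) ∉ D} = 0} := by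
      ext p
      have hDp : MeasurableSet {i | condAct hF n (p, i) ∈ D} :=
        ((measurable_condAct hF n).comp measurable_prodMk_left) hD
      rw [Set.mem_ofPred_eq, Set.mem_ofPred_eq, map_fst_infoActLaw,
        Measure.map_map (measurable_infoOf hF n) (measurable_histOf n),
        ae_map_iff hio.aemeasurable hDp, ae_iff]
      rfl
    exact (heq ▸ measurableSet_eq_fun hm measurable_const :
      MeasurableSet {p : ProbabilityMeasure (TrajO X Z A) |
        ∀ᵐ i ∂(infoActLaw hF n p).toMeasure.map Prod.fst, condAct hF n (p, i) ∈ D}).analyticSet'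

end StrategicSet

section Characterization

variable {X Z A : Type*} [TopologicalSpace X] [PolishSpace X] [MeasurableSpace X] [BorelSpace X]
  [TopologicalSpace Z] [PolishSpace Z] [MeasurableSpace Z] [BorelSpace Z]
  [TopologicalSpace A] [PolishSpace A] [MeasurableSpace A] [BorelSpace A]
  {q : Kernel (X × A) X} [IsMarkovKernel q] {F : X → Z}

/-- The information vector and action determined by the history of the next stage. -/
def lastInfoAct (F : X → Z) {n : ℕ} (h : HistO X Z A (n + 1)) : Info Z A n × A :=
  (infoOf F (fun k => h.1 k.castSucc, (h.1 (Fin.last n)).1), (h.1 (Fin.last n)).2.2)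

theorem measurable_lastInfoAct (hF : Measurable F) (n : ℕ) :
    Measurable (lastInfoAct F : HistO X Z A (n + 1) → Info Z A n × A) :=
  ((measurable_infoOf hF n).comp (by fun_prop)).prodMk (by fun_prop)

theorem lastInfoAct_extendHist (F : X → Z) {n : ℕ} (h : HistO X Z A n) (a : A) (y : X) :
    lastInfoAct F (extendHist F h a y) = (infoOf F h, a) := by
  simp [lastInfoAct, extendHist]

theorem AnalyticSet.section_fst {I B : Type*} [TopologicalSpace I] [T2Space I]
    [TopologicalSpace B] [PolishSpace B] [SecondCountableTopology I] [MeasurableSpace I]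
    [BorelSpace I] [MeasurableSpace B] [BorelSpace B] {s : Set (I × B)} (hs : AnalyticSet s)
    (i : I) : AnalyticSet (Prod.mk i ⁻¹' s) :=
  hs.preimage_measurable measurable_prodMk_left

theorem infoActLaw_apply (hF : Measurable F) {κ : ∀ n, Info Z A n → ProbabilityMeasure A}
    (hκ : ∀ n, Measurable[umSpace _] (κ n)) {p0 : Measure X} [IsProbabilityMeasure p0]
    {p : ProbabilityMeasure (TrajO X Z A)}
    (hp : ∀ n, p.toMeasure.map (histOf n) = histLaw p0 F q κ n) (n : ℕ)
    {s : Set (Info Z A n × A)} (hs : MeasurableSet s) :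
    (infoActLaw hF n p).toMeasure s =
      ∫⁻ i, (κ n i).toMeasure (Prod.mk i ⁻¹' s) ∂(infoActLaw hF n p).toMeasure.map Prod.fst := by
  have hprob := isProbabilityMeasure_histLaw (q := q) hF hκ p0 n
  have hio := measurable_infoOf (X := X) (A := A) hF n
  have hL := measurable_lastInfoAct (A := A) hF n
  have hprob' := Measure.isProbabilityMeasure_map (μ := histLaw p0 F q κ n) hio.aemeasurable
  have hstep := aemeasurable_step (q := q) hF (hκ n) (histLaw p0 F q κ n)
  have hsec : AEMeasurable (fun i => (κ n i).toMeasure (Prod.mk i ⁻¹' s))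
      ((histLaw p0 F q κ n).map (infoOf F)) :=
    (measurable_prod_section hs).comp_aemeasurable
      (aemeasurable_id.prodMk (aemeasurable_of_umSpace (hκ n) _))
  have hcomp : p.toMeasure.map (infoAct F n) =
      (p.toMeasure.map (histOf (n + 1))).map (lastInfoAct F) := by
    rw [Measure.map_map hL (measurable_histOf _)]
    rfl
  rw [map_fst_infoActLaw, hp n, lintegral_map' hsec hio.aemeasurable, toMeasure_infoActLaw, hcomp,
    hp (n + 1), Measure.map_apply hL hs, histLaw, Measure.bind_apply (hL hs) hstep]
  refine lintegral_congr fun h => ?_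
  rw [← lintegral_indicator_one (hL hs),
    lintegral_stepKernel hF _ _ (measurable_one.indicator (hL hs)),
    ← lintegral_indicator_one (measurable_prodMk_left hs)]
  refine lintegral_congr fun a => ?_
  have hind : ∀ y, (lastInfoAct F ⁻¹' s).indicator (1 : HistO X Z A (n + 1) → ℝ≥0∞)
      (extendHist F h a y) = (Prod.mk (infoOf F h) ⁻¹' s).indicator 1 a := fun y => by
    change s.indicator (1 : Info Z A n × A → ℝ≥0∞) (lastInfoAct F (extendHist F h a y)) =
      s.indicator 1 (infoOf F h, a)
    rw [lastInfoAct_extendHist]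
  rw [lintegral_congr hind]
  simp

variable [Nonempty A]

theorem condAct_ae_eq (hF : Measurable F) {κ : ∀ n, Info Z A n → ProbabilityMeasure A}
    (hκ : ∀ n, Measurable[umSpace _] (κ n)) {p0 : Measure X} [IsProbabilityMeasure p0]
    {p : ProbabilityMeasure (TrajO X Z A)}
    (hp : ∀ n, p.toMeasure.map (histOf n) = histLaw p0 F q κ n) (n : ℕ) :
    (fun i => condAct hF n (p, i)) =ᵐ[(infoActLaw hF n p).toMeasure.map Prod.fst] κ n := by
  have := Measure.isProbabilityMeasure_map (μ := (infoActLaw hF n p).toMeasure)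
    (measurable_fst (α := Info Z A n) (β := A)).aemeasurable
  exact condDist_ae_eq (infoActLaw hF n p) (aemeasurable_of_umSpace (hκ n) _)
    fun s hs => infoActLaw_apply hF hκ hp n hs

theorem ae_map_infoOf {n : ℕ} (hF : Measurable F) {p : ProbabilityMeasure (TrajO X Z A)}
    {P : Info Z A n → Prop} (h : ∀ᵐ i ∂(infoActLaw hF n p).toMeasure.map Prod.fst, P i) :
    ∀ᵐ h ∂p.toMeasure.map (histOf n), P (infoOf F h) := by
  rw [map_fst_infoActLaw] at h
  exact ae_of_ae_map (measurable_infoOf hF n).aemeasurable h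

theorem mem_strategicSet (hF : Measurable F) {U : ∀ n : ℕ, Info Z A n → Set A}
    (hU : ∀ n : ℕ, AnalyticSet {ia : Info Z A n × A | ia.2 ∈ U n ia.1})
    {D : Set (ProbabilityMeasure A)} {κ : ∀ n, Info Z A n → ProbabilityMeasure A}
    (hκ : ∀ n, Measurable[umSpace _] (κ n)) (hκD : ∀ n i, κ n i ∈ D)
    (hκU : ∀ n i, (κ n i).toMeasure (U n i) = 1) {p0 : Measure X} [IsProbabilityMeasure p0]
    {p : ProbabilityMeasure (TrajO X Z A)}
    (hp : ∀ n, p.toMeasure.map (histOf n) = histLaw p0 F q κ n) :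
    p ∈ strategicSet q hF U D := by
  intro n
  have hae := condAct_ae_eq hF hκ hp n
  refine ⟨?_, ?_, ?_⟩
  · rw [hp (n + 1), histLaw, hp n]
    refine Measure.bind_congr_right ?_
    rw [← hp n]
    filter_upwards [ae_map_infoOf hF hae] with h hh
    rw [hh]
  · have hnull := (hU n).nullMeasurableSet (infoActLaw hF n p).toMeasure
    obtain ⟨N, hNsub, hN, hNae⟩ := hnull.compl.exists_measurable_subset_ae_eq
    refine ((prob_compl_eq_zero_iff₀ hnull).1 ?_).ge
    rw [← measure_congr hNae, infoActLaw_apply hF hκ hp n hN]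
    refine (lintegral_congr fun i => ?_).trans lintegral_zero
    refine measure_mono_null (fun a ha => hNsub ha)
      ((prob_compl_eq_zero_iff₀ ?_).2 (hκU n i))
    exact (AnalyticSet.section_fst (hU n) i).nullMeasurableSet _
  · filter_upwards [hae] with i hi
    rw [hi]
    exact hκD n i

theorem map_histOf_eq_histLaw (hF : Measurable F) {U : ∀ n : ℕ, Info Z A n → Set A}
    {D : Set (ProbabilityMeasure A)} {p : ProbabilityMeasure (TrajO X Z A)}
    (hp : p ∈ strategicSet q hF U D) {κ : ∀ n, Info Z A n → ProbabilityMeasure A}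
    (hκ : ∀ n, (fun i => condAct hF n (p, i))
      =ᵐ[(infoActLaw hF n p).toMeasure.map Prod.fst] κ n) (n : ℕ) :
    p.toMeasure.map (histOf n) = histLaw (p.toMeasure.map fun ω => (ω 0).1) F q κ n := by
  induction n with
  | zero =>
    rw [histLaw, Measure.map_map (by fun_prop) (by fun_prop)]
    congr 1
    funext ω
    exact Prod.ext (Subsingleton.elim _ _) rfl
  | succ n ih =>
    rw [(hp n).1, histLaw, ← ih]
    refine Measure.bind_congr_right ?_
    filter_upwards [ae_map_infoOf hF (hκ n)] with h hh
    rw [hh]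

/-- Replacement of an action law that violates the constraint set or does not belong to `D` by the
Dirac mass of a prescribed action. -/
def repairAct {I : Type*} (U : I → Set A) (D : Set (ProbabilityMeasure A)) (sel : I → A)
    (z : I × ProbabilityMeasure A) : ProbabilityMeasure A :=
  open Classical in if 1 ≤ z.2.toMeasure (U z.1) ∧ z.2 ∈ D then z.2 else diracProba (sel z.1)

theorem measurable_repairAct {I : Type*} [TopologicalSpace I] [PolishSpace I] [MeasurableSpace I]
    [BorelSpace I] {U : I → Set A} (hU : AnalyticSet {ia : I × A | ia.2 ∈ U ia.1})
    {D : Set (ProbabilityMeasure A)} (hD : MeasurableSet D) {sel : I → A}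
    (hsel : Measurable[umSpace I] sel) : Measurable[umSpace _] (repairAct U D sel) := by
  let Q : I × ProbabilityMeasure A → ProbabilityMeasure (I × A) := fun z =>
    ⟨(Measure.dirac z.1).prod z.2.toMeasure, inferInstance⟩
  have hQ : Measurable Q := by
    refine measurable_prob_iff.2 fun s hs => ?_
    have : ∀ z, (Q z).toMeasure s = z.2.toMeasure (Prod.mk z.1 ⁻¹' s) := fun z => by
      change ((Measure.dirac z.1).prod z.2.toMeasure) s = _
      rw [Measure.dirac_prod, Measure.map_apply measurable_prodMk_left hs]
    simp only [this]
    exact measurable_prod_section hs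
  have hset : AnalyticSet {z : I × ProbabilityMeasure A | 1 ≤ z.2.toMeasure (U z.1)} := by
    convert ((usa_measure hU).le 1).preimage_measurable hQ using 1
    ext z
    have hsec : (Q z).toMeasure {ia : I × A | ia.2 ∈ U ia.1} = z.2.toMeasure (U z.1) := by
      change ((Measure.dirac z.1).prod z.2.toMeasure) _ = _
      rw [Measure.dirac_prod, Measure.map_apply₀ measurable_prodMk_left.aemeasurable
        (hU.nullMeasurableSet _)]
      rfl
    rw [Set.mem_ofPred_eq, Set.mem_preimage, Set.mem_ofPred_eq, hsec]
  have hDset : MeasurableSet[umSpace (I × ProbabilityMeasure A)]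
      {z : I × ProbabilityMeasure A | z.2 ∈ D} := le_umSpace _ _ (measurable_snd hD)
  have hdir : Measurable (diracProba : A → ProbabilityMeasure A) :=
    continuous_diracProba.measurable
  unfold repairAct
  exact Measurable.ite (m := umSpace (I × ProbabilityMeasure A))
    (MeasurableSet.inter (m := umSpace _) hset.measurableSet_umSpace hDset)
    measurable_snd.universallyMeasurable
    (hdir.comp (hsel.comp (measurable_umSpace_umSpace measurable_fst.universallyMeasurable)))

theorem repairAct_mem {I : Type*} {U : I → Set A} {D : Set (ProbabilityMeasure A)} {sel : I → A}
    (hdir : ∀ a, diracProba a ∈ D) (z : I × ProbabilityMeasure A) : repairAct U D sel z ∈ D := by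
  unfold repairAct
  split_ifs with h
  · exact h.2
  · exact hdir _

theorem repairAct_apply {I : Type*} {U : I → Set A} {D : Set (ProbabilityMeasure A)} {sel : I → A}
    (hsel : ∀ i, sel i ∈ U i) (z : I × ProbabilityMeasure A) :
    (repairAct U D sel z).toMeasure (U z.1) = 1 := by
  unfold repairAct
  split_ifs with h
  · exact le_antisymm prob_le_one h.1
  · exact Measure.dirac_apply_of_mem (hsel _)

theorem condAct_ae_eq_repairAct (hF : Measurable F) {U : ∀ n : ℕ, Info Z A n → Set A}
    (hU : ∀ n : ℕ, AnalyticSet {ia : Info Z A n × A | ia.2 ∈ U n ia.1})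
    {D : Set (ProbabilityMeasure A)} {p : ProbabilityMeasure (TrajO X Z A)}
    (hp : p ∈ strategicSet q hF U D) (n : ℕ) (sel : Info Z A n → A) :
    (fun i => condAct hF n (p, i)) =ᵐ[(infoActLaw hF n p).toMeasure.map Prod.fst]
      fun i => repairAct (U n) D sel (i, condAct hF n (p, i)) := by
  obtain ⟨-, hfeas, hmem⟩ := hp n
  obtain ⟨M, hM, hMm, hM0⟩ := exists_measurable_superset_of_null
    (ae_mem_of_one_le (hU n) hfeas)
  rw [← lintegral_indicator_one hMm, lintegral_condDist _ (measurable_one.indicator hMm)] at hM0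
  have hmeas : Measurable fun i =>
      (condDist (infoActLaw hF n p, i)).toMeasure (Prod.mk i ⁻¹' M) :=
    (measurable_prod_section hMm).comp
      (measurable_id.prodMk (measurable_condDist.comp measurable_prodMk_left))
  have hM1 : ∫⁻ i, (condDist (infoActLaw hF n p, i)).toMeasure (Prod.mk i ⁻¹' M)
      ∂(infoActLaw hF n p).toMeasure.map Prod.fst = 0 := by
    rw [← hM0]
    refine lintegral_congr fun i => ?_
    rw [← lintegral_indicator_one (measurable_prodMk_left hMm)]
    rfl
  rw [lintegral_eq_zero_iff hmeas] at hM1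
  filter_upwards [hM1, hmem] with i hi hiD
  have hU1 : 1 ≤ (condAct hF n (p, i)).toMeasure (U n i) := by
    refine ((prob_compl_eq_zero_iff₀ ?_).1 (measure_mono_null ?_ hi)).ge
    · exact (AnalyticSet.section_fst (hU n) i).nullMeasurableSet _
    · exact fun a ha => hM ha
  rw [repairAct, if_pos ⟨hU1, hiD⟩]

end Characterization

section Existence

theorem exists_markovChain {E : ℕ → Type*} [∀ n, MeasurableSpace (E n)] (μ : Measure (E 0))
    [IsProbabilityMeasure μ] (K : ∀ n, Kernel (E n) (E (n + 1))) [∀ n, IsMarkovKernel (K n)] :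
    ∃ P : Measure (∀ n, E n), IsProbabilityMeasure P ∧ P.map (fun x => x 0) = μ ∧
      ∀ n, P.map (fun x => (x n, x (n + 1))) = P.map (fun x => x n) ⊗ₘ K n := by
  let lastCoord : ∀ n, (∀ i : Finset.Iic n, E i.1) → E n := fun n x =>
    x ⟨n, Finset.mem_Iic.2 le_rfl⟩
  have hproj : ∀ n, Measurable (lastCoord n) := fun n => measurable_pi_apply _
  let κ : ∀ n, Kernel (∀ i : Finset.Iic n, E i.1) (E (n + 1)) := fun n => (K n).comap _ (hproj n)
  have hκ : ∀ n, IsMarkovKernel (κ n) := fun n => Kernel.IsMarkovKernel.comap _ (hproj n)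
  refine ⟨Kernel.trajMeasure μ κ, inferInstance, ?_, fun n => ?_⟩
  · have hcomp : (fun x : ∀ n, E n => x 0) = lastCoord 0 ∘ Preorder.frestrictLe 0 := rfl
    rw [hcomp, ← Measure.map_map (hproj 0) (by fun_prop), Kernel.trajMeasure,
      Measure.map_comp _ _ (by fun_prop), Kernel.traj_map_frestrictLe, Kernel.partialTraj_self,
      Measure.id_comp]
    exact (Measure.map_map (hproj 0) (MeasurableEquiv.measurable _)).trans Measure.map_id
  · have h := Kernel.map_frestrictLe_trajMeasure_compProd_eq_map_trajMeasure (μ₀ := μ) (κ := κ)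
      (a := n)
    have hpair : (fun x : ∀ n, E n => (x n, x (n + 1))) =
        (Prod.map (lastCoord n) id) ∘
          fun x => (Preorder.frestrictLe n x, x (n + 1)) := rfl
    have hone : (fun x : ∀ n, E n => x n) =
        lastCoord n ∘ Preorder.frestrictLe n := rfl
    rw [hpair, ← Measure.map_map ((hproj n).prodMap measurable_id) (by fun_prop), ← h, hone,
      ← Measure.map_map (hproj n) (by fun_prop)]
    have := Measure.isProbabilityMeasure_map (μ := Kernel.trajMeasure μ κ)
      (f := Preorder.frestrictLe n) (by fun_prop)
    have := Measure.isProbabilityMeasure_map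
      (μ := (Kernel.trajMeasure μ κ).map (Preorder.frestrictLe n)) (hproj n).aemeasurable
    ext s hs
    rw [Measure.map_apply ((hproj n).prodMap measurable_id) hs,
      Measure.compProd_apply (((hproj n).prodMap measurable_id) hs), Measure.compProd_apply hs,
      lintegral_map (Kernel.measurable_kernel_prodMk_left hs) (hproj n)]
    rfl

variable {X Z A : Type*} [TopologicalSpace X] [PolishSpace X] [MeasurableSpace X] [BorelSpace X]
  [TopologicalSpace Z] [PolishSpace Z] [MeasurableSpace Z] [BorelSpace Z]
  [TopologicalSpace A] [PolishSpace A] [MeasurableSpace A] [BorelSpace A]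
  {q : Kernel (X × A) X} [IsMarkovKernel q] {F : X → Z}

/-- The consistency relation between the histories at two consecutive stages. -/
def IsExtension (F : X → Z) {n : ℕ} (h : HistO X Z A n) (w : HistO X Z A (n + 1)) : Prop :=
  w = extendHist F h (w.1 (Fin.last n)).2.2 w.2

theorem measurableSet_isExtension (hF : Measurable F) (n : ℕ) :
    MeasurableSet {z : HistO X Z A n × HistO X Z A (n + 1) | IsExtension F z.1 z.2} :=
  measurableSet_eq_fun measurable_snd ((measurable_extendHist hF n).comp
    (measurable_fst.prodMk (Measurable.prodMk (by fun_prop) (by fun_prop))))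

theorem ae_isExtension_stepKernel (hF : Measurable F) {n : ℕ} (h : HistO X Z A n)
    (κ : ProbabilityMeasure A) : ∀ᵐ w ∂(stepKernel q F n (h, κ)), IsExtension F h w := by
  have hm : MeasurableSet {w : HistO X Z A (n + 1) | ¬ IsExtension F h w} :=
    (measurable_prodMk_left (measurableSet_isExtension hF n)).compl
  rw [ae_iff, ← lintegral_indicator_one hm,
    lintegral_stepKernel hF h κ (measurable_one.indicator hm)]
  simp [Set.indicator, IsExtension, extendHist]

theorem histOf_eq_of_isExtension {x : ∀ n, HistO X Z A n}
    (hx : ∀ n, IsExtension F (x n) (x (n + 1))) (n : ℕ) :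
    histOf n (fun k => (x (k + 1)).1 (Fin.last k)) = x n := by
  have hsnd : ∀ n, ((x (n + 1)).1 (Fin.last n)).1 = (x n).2 := fun n => by
    rw [hx n]
    simp [extendHist]
  have hfst : ∀ n (i : Fin n), (x (i + 1)).1 (Fin.last i) = (x n).1 i := by
    intro n
    induction n with
    | zero => exact fun i => i.elim0
    | succ n ih =>
      refine Fin.lastCases rfl fun i => ?_
      refine (ih i).trans ?_
      rw [hx n]
      simp [extendHist]
  exact Prod.ext (funext (hfst n)) (hsnd n)

theorem exists_map_histOf_eq_histLaw (hF : Measurable F)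
    {κ : ∀ n, Info Z A n → ProbabilityMeasure A} (hκ : ∀ n, Measurable[umSpace _] (κ n))
    (p0 : ProbabilityMeasure X) :
    ∃ p : ProbabilityMeasure (TrajO X Z A),
      ∀ n, p.toMeasure.map (histOf n) = histLaw p0.toMeasure F q κ n := by
  have hL := isProbabilityMeasure_histLaw (q := q) hF hκ p0.toMeasure
  have hio := measurable_infoOf (X := X) (A := A) hF
  have hLi : ∀ n, IsProbabilityMeasure ((histLaw p0.toMeasure F q κ n).map (infoOf F)) := fun n =>
    Measure.isProbabilityMeasure_map (hio n).aemeasurable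
  have hae : ∀ n, AEMeasurable (κ n) ((histLaw p0.toMeasure F q κ n).map (infoOf F)) := fun n =>
    aemeasurable_of_umSpace (hκ n) _
  have hmk : ∀ n, Measurable fun h : HistO X Z A n => (h, (hae n).mk (κ n) (infoOf F h)) :=
    fun n => measurable_id.prodMk ((hae n).measurable_mk.comp (hio n))
  let K : ∀ n, Kernel (HistO X Z A n) (HistO X Z A (n + 1)) := fun n =>
    (stepKernel q F n).comap _ (hmk n)
  have hK : ∀ n, IsMarkovKernel (K n) := fun n =>
    have := isMarkovKernel_stepKernel (q := q) (A := A) hF n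
    Kernel.IsMarkovKernel.comap _ (hmk n)
  obtain ⟨P, hP, hP0, hPn⟩ := exists_markovChain (histLaw p0.toMeasure F q κ 0) K
  have hPprob : ∀ n, IsProbabilityMeasure (P.map fun x : ∀ n, HistO X Z A n => x n) := fun n =>
    Measure.isProbabilityMeasure_map (measurable_pi_apply n).aemeasurable
  have hext : ∀ᵐ x ∂P, ∀ n, IsExtension F (x n) (x (n + 1)) := by
    refine ae_all_iff.2 fun n => ?_
    have hpair : ∀ᵐ z ∂(P.map fun x => x n) ⊗ₘ K n, IsExtension F z.1 z.2 :=
      Measure.ae_compProd_of_ae_ae (measurableSet_isExtension hF n)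
        (ae_of_all _ fun h => ae_isExtension_stepKernel hF h _)
    rw [← hPn n] at hpair
    exact ae_of_ae_map (by fun_prop) hpair
  have hlaw : ∀ n, (P.map fun x => x n) = histLaw p0.toMeasure F q κ n := by
    intro n
    induction n with
    | zero => exact hP0
    | succ n ih =>
      have hsnd : (P.map fun x => x (n + 1)) = (P.map fun x => (x n, x (n + 1))).snd := by
        rw [Measure.snd, Measure.map_map measurable_snd (by fun_prop)]
        rfl
      rw [hsnd, hPn n, Measure.snd_compProd, ih, histLaw]
      refine Measure.bind_congr_right ?_
      filter_upwards [ae_of_ae_map (hio n).aemeasurable (hae n).ae_eq_mk] with h hh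
      rw [hh]
      rfl
  have hT : Measurable fun (x : ∀ n, HistO X Z A n) (k : ℕ) => (x (k + 1)).1 (Fin.last k) := by
    fun_prop
  refine ⟨⟨P.map _, Measure.isProbabilityMeasure_map hT.aemeasurable⟩, fun n => ?_⟩
  rw [ProbabilityMeasure.coe_mk, Measure.map_map (measurable_histOf n) hT, ← hlaw n]
  refine Measure.map_congr ?_
  filter_upwards [hext] with x hx
  exact histOf_eq_of_isExtension hx n

end Existence

section Optimality

variable {X Z A : Type*} [TopologicalSpace X] [PolishSpace X] [MeasurableSpace X] [BorelSpace X]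
  [TopologicalSpace Z] [PolishSpace Z] [MeasurableSpace Z] [BorelSpace Z]
  [TopologicalSpace A] [PolishSpace A] [MeasurableSpace A] [BorelSpace A]
  {q : Kernel (X × A) X} [IsMarkovKernel q] {F : X → Z}

/-- The initial distribution of a trajectory law. -/
def initialLaw (p : ProbabilityMeasure (TrajO X Z A)) : ProbabilityMeasure X :=
  p.map (measurable_pi_apply (0 : ℕ)).fst.aemeasurable

theorem continuous_initialLaw :
    Continuous (initialLaw : ProbabilityMeasure (TrajO X Z A) → ProbabilityMeasure X) :=
  ProbabilityMeasure.continuous_map (by fun_prop)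

theorem initialLaw_eq {p : ProbabilityMeasure (TrajO X Z A)} {p0 : ProbabilityMeasure X}
    {κ : ∀ n, Info Z A n → ProbabilityMeasure A}
    (h : p.toMeasure.map (histOf 0) = histLaw p0.toMeasure F q κ 0) : initialLaw p = p0 := by
  refine Subtype.ext ?_
  have h' := congrArg (Measure.map Prod.snd) h
  rw [histLaw, Measure.map_map measurable_snd (measurable_histOf 0),
    Measure.map_map measurable_snd (by fun_prop)] at h'
  exact h'.trans Measure.map_id

variable [Nonempty A] {U : ∀ n : ℕ, Info Z A n → Set A} {D : Set (ProbabilityMeasure A)}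

theorem exists_feasible_selection (hne : ∀ n i, (U n i).Nonempty)
    (hU : ∀ n : ℕ, AnalyticSet {ia : Info Z A n × A | ia.2 ∈ U n ia.1}) (n : ℕ) :
    ∃ sel : Info Z A n → A, Measurable[umSpace _] sel ∧ ∀ i, sel i ∈ U n i := by
  obtain ⟨sel, hsel, h⟩ := exists_selection (hU n)
  exact ⟨sel, hsel, fun i => h i _ (hne n i).some_mem⟩

theorem exists_policy_inducing (hF : Measurable F) (hne : ∀ n i, (U n i).Nonempty)
    (hU : ∀ n : ℕ, AnalyticSet {ia : Info Z A n × A | ia.2 ∈ U n ia.1})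
    (hD : MeasurableSet D) (hdir : ∀ a, diracProba a ∈ D)
    {R : ProbabilityMeasure X → ProbabilityMeasure (TrajO X Z A)}
    (hR : Measurable[umSpace _] R) :
    ∃ π : PolicyI X U, (∀ n ip, π.prob n ip ∈ D) ∧
      ∀ p0, R p0 ∈ strategicSet q hF U D → initialLaw (R p0) = p0 →
        InducesI q F π p0 (R p0).toMeasure := by
  choose sel hsel hselU using exists_feasible_selection hne hU
  let κ : ∀ n, Info Z A n × ProbabilityMeasure X → ProbabilityMeasure A := fun n ip =>
    repairAct (U n) D (sel n) (ip.1, condAct hF n (R ip.2, ip.1))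
  have hκ : ∀ n, Measurable[umSpace _] (κ n) := fun n => by
    have hfst : Measurable[umSpace _] (Prod.fst : Info Z A n × ProbabilityMeasure X → _) :=
      measurable_fst.universallyMeasurable
    have hRsnd : Measurable[umSpace _] fun ip : Info Z A n × ProbabilityMeasure X => R ip.2 :=
      hR.comp (measurable_umSpace_umSpace measurable_snd.universallyMeasurable)
    have hact : Measurable[umSpace _] fun ip : Info Z A n × ProbabilityMeasure X =>
        condAct hF n (R ip.2, ip.1) :=
      (measurable_condAct hF n).comp
        (Measurable.prodMk (m := umSpace (Info Z A n × ProbabilityMeasure X)) hRsnd hfst)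
    exact (measurable_repairAct (hU n) hD (hsel n)).comp (measurable_umSpace_umSpace
      (Measurable.prodMk (m := umSpace (Info Z A n × ProbabilityMeasure X)) hfst hact))
  let π : PolicyI X U :=
    { μ := fun n ip => (κ n ip).toMeasure
      isProb := fun n ip => inferInstance
      umeas := fun n B hB => (measurable_prob_apply hB).comp (hκ n)
      feasible := fun n i p0 => repairAct_apply (hselU n) _ }
  refine ⟨π, fun n ip => repairAct_mem hdir _, fun p0 hp hp0 => ?_⟩
  refine (inducesI_iff_map_histOf hF π p0 _).2 fun n => ?_
  have h := map_histOf_eq_histLaw hF hp (κ := fun n i => κ n (i, p0))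
    (fun n => condAct_ae_eq_repairAct hF hU hp n (sel n)) n
  rw [h]
  exact congrArg (fun r : ProbabilityMeasure X =>
    histLaw r.toMeasure F q (fun n i => κ n (i, p0)) n) hp0

theorem exists_mem_strategicSet (hF : Measurable F) (hne : ∀ n i, (U n i).Nonempty)
    (hU : ∀ n : ℕ, AnalyticSet {ia : Info Z A n × A | ia.2 ∈ U n ia.1})
    (hdir : ∀ a, diracProba a ∈ D) (p0 : ProbabilityMeasure X) :
    ∃ p ∈ strategicSet q hF U D, initialLaw p = p0 := by
  choose sel hsel hselU using exists_feasible_selection hne hU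
  have hκ : ∀ n, Measurable[umSpace _] fun i => diracProba (sel n i) := fun n =>
    (continuous_diracProba.measurable).comp (hsel n)
  obtain ⟨p, hp⟩ := exists_map_histOf_eq_histLaw (q := q) hF hκ p0
  exact ⟨p, mem_strategicSet hF hU hκ (fun n i => hdir _)
    (fun n i => Measure.dirac_apply_of_mem (hselU n i)) hp, initialLaw_eq (hp 0)⟩

theorem InducesI.mem_strategicSet (hF : Measurable F)
    (hU : ∀ n : ℕ, AnalyticSet {ia : Info Z A n × A | ia.2 ∈ U n ia.1}) {π : PolicyI X U}
    (hπ : ∀ n ip, π.prob n ip ∈ D) {p0 : ProbabilityMeasure X}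
    {p : ProbabilityMeasure (TrajO X Z A)} (h : InducesI q F π p0 p.toMeasure) :
    p ∈ strategicSet q hF U D ∧ initialLaw p = p0 := by
  have hp := (inducesI_iff_map_histOf hF π p0 _).1 h
  exact ⟨PaperStmt.mem_strategicSet hF hU
    (fun n => measurable_umSpace_section (π.measurable_prob n) p0) (fun n i => hπ n _)
    (fun n i => π.feasible n i p0) hp, initialLaw_eq (hp 0)⟩

theorem gOptI_eq_fibreInf (hF : Measurable F) (hne : ∀ n i, (U n i).Nonempty)
    (hU : ∀ n : ℕ, AnalyticSet {ia : Info Z A n × A | ia.2 ∈ U n ia.1})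
    (hD : MeasurableSet D) (hdir : ∀ a, diracProba a ∈ D) {C : PolicyI X U → Prop}
    (hC : ∀ π, C π ↔ ∀ n ip, π.prob n ip ∈ D)
    (J : ProbabilityMeasure (TrajO X Z A) → EReal) :
    gOptI q F C J = fibreInf (strategicSet q hF U D) initialLaw J := by
  funext p0
  refine le_antisymm (le_iInf₂ fun p hp => ?_)
    (le_iInf₂ fun π hπ => le_iInf₂ fun p hp => iInf₂_le p (hp.mem_strategicSet hF hU ((hC π).1 hπ)))
  obtain ⟨π, hπ, hind⟩ := exists_policy_inducing (q := q) hF hne hU hD hdir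
    (R := fun _ => p) (@measurable_const _ _ _ (umSpace _) _)
  exact (iInf₂_le π ((hC π).2 hπ)).trans (iInf₂_le p (hind p0 hp.1 hp.2))

theorem lowerSemianalytic_gOptI_and_goodPolicyI (hF : Measurable F)
    (hne : ∀ n i, (U n i).Nonempty)
    (hU : ∀ n : ℕ, AnalyticSet {ia : Info Z A n × A | ia.2 ∈ U n ia.1})
    (hD : MeasurableSet D) (hdir : ∀ a, diracProba a ∈ D) {C : PolicyI X U → Prop}
    (hC : ∀ π, C π ↔ ∀ n ip, π.prob n ip ∈ D) [Nonempty (ProbabilityMeasure X)]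
    {J : ProbabilityMeasure (TrajO X Z A) → EReal} (hJ : LSA J) :
    LowerSemianalytic (gOptI q F C J) ∧ ∀ ε : ℝ, 0 < ε → GoodPolicyI q F C J ε := by
  have hS := analyticSet_strategicSet (q := q) hF hU hD
  have hsurj := exists_mem_strategicSet (q := q) (D := D) hF hne hU hdir
  have hg := gOptI_eq_fibreInf (q := q) hF hne hU hD hdir hC J
  have : Nonempty (ProbabilityMeasure (TrajO X Z A)) := ⟨(hsurj (Classical.arbitrary _)).choose⟩
  refine ⟨hg ▸ lowerSemianalytic_iff_lsa.2 (LSA.fibreInf hS continuous_initialLaw hJ),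
    fun ε hε => ?_⟩
  obtain ⟨R, hR, hRp⟩ := exists_measurable_nearMinimizer hS continuous_initialLaw hsurj hJ hε
  obtain ⟨π, hπ, hind⟩ := exists_policy_inducing (q := q) hF hne hU hD hdir hR
  rw [GoodPolicyI, hg]
  exact ⟨π, R, (hC π).2 hπ, fun p0 => hind p0 (hRp p0).1 (hRp p0).2.1,
    fun p0 => ⟨(hRp p0).2.2.1, (hRp p0).2.2.2.1⟩, fun p0 ⟨π', p, hπ', hp, hopt⟩ =>
    (hRp p0).2.2.2.2 ⟨p, (hp.mem_strategicSet hF hU ((hC π').1 hπ')).1,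
      (hp.mem_strategicSet hF hU ((hC π').1 hπ')).2, hopt⟩⟩

end Optimality

end PaperStmt

namespace PaperStmt

variable {X Z A : Type*} [MeasurableSpace X] [TopologicalSpace X] [OpensMeasurableSpace X]
  [MeasurableSpace Z] [MeasurableSpace A]

/-- Theorem `thm-pomdp-opt`: for the partially observable model with a
real-valued, bounded above or below, lower semianalytic one-stage cost and any of the
average cost or risk criteria, the optimal value function on `P(𝕏)` is lower
semianalytic, and for each `ε > 0` there is an `ε`-optimal policy in `Π_I` (resp. `Π'_I`)
that is optimal at every initial distribution admitting an optimal policy. -/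
theorem statement14
    {X Z A : Type*} [TopologicalSpace X] [PolishSpace X] [MeasurableSpace X] [BorelSpace X]
    [TopologicalSpace Z] [PolishSpace Z] [MeasurableSpace Z] [BorelSpace Z]
    [TopologicalSpace A] [PolishSpace A] [MeasurableSpace A] [BorelSpace A]
    (q : Kernel (X × A) X) [IsMarkovKernel q]
    (F : X → Z) (hF : Measurable F)
    (U : ∀ n : ℕ, Info Z A n → Set A)
    (hne : ∀ n i, (U n i).Nonempty)
    (hΓ : ∀ n : ℕ, MeasureTheory.AnalyticSet {ia : Info Z A n × A | ia.2 ∈ U n ia.1})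
    (c : X × A → EReal) (hc : LowerSemianalytic c)
    (hreal : ∀ xa : X × A, c xa ≠ ⊤ ∧ c xa ≠ ⊥)
    (hbdd : (∃ b : ℝ, ∀ xa : X × A, c xa ≤ (b : EReal)) ∨
            (∃ b : ℝ, ∀ xa : X × A, (b : EReal) ≤ c xa))
    (J : ProbabilityMeasure (TrajO X Z A) → EReal)
    (hJ : J = J1O c ∨ J = J2O c ∨ J = J3O c ∨ J = J4O c ∨
          J = Jt1O c ∨ J = Jt2O c ∨ J = Jt3O c ∨ J = Jt4O c ∨
          (∃ (ψ : EReal → ℝ≥0∞) (ψinv : ℝ≥0∞ → EReal), StrictMono ψ ∧ Continuous ψ ∧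
            Monotone ψinv ∧ (∀ y : EReal, ψinv (ψ y) = y) ∧ J = JpsiO c ψ ψinv) ∨
          (∃ (ψ : EReal → ℝ≥0∞) (ψinv : ℝ≥0∞ → EReal), StrictMono ψ ∧ Continuous ψ ∧
            Monotone ψinv ∧ (∀ y : EReal, ψinv (ψ y) = y) ∧ J = JpsiHatO c ψ ψinv) ∨
          (∃ α : ℝ, 0 < α ∧ α ≤ 1 ∧ J = RcvarO c α) ∨
          (∃ α : ℝ, 0 < α ∧ α ≤ 1 ∧ J = RvarO c α)) :
    ∀ C : PolicyI X U → Prop, ((C = fun _ => True) ∨ C = PolicyI.Nonrandomized) →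
      LowerSemianalytic (gOptI q F C J) ∧
      ∀ ε : ℝ, 0 < ε → GoodPolicyI q F C J ε := by

  intro C hC
  have hc' := lowerSemianalytic_iff_lsa.1 hc
  have hJ' : LSA J := by
    rcases hJ with rfl | rfl | rfl | rfl | rfl | rfl | rfl | rfl | ⟨ψ, ψinv, hψ, -, hψinv, -, rfl⟩ |
      ⟨ψ, ψinv, hψ, -, hψinv, -, rfl⟩ | ⟨α, -, -, rfl⟩ | ⟨α, -, -, rfl⟩
    · exact hc'.J1O
    · exact hc'.J2O
    · exact hc'.J3O
    · exact hc'.J4O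
    · exact hc'.Jt1O
    · exact hc'.Jt2O
    · exact hc'.Jt3O
    · exact hc'.Jt4O
    · exact hc'.JpsiO hψ.monotone hψinv
    · exact hc'.JpsiHatO hψ.monotone hψinv
    · exact hc'.RcvarO α
    · exact hc'.RvarO α
  obtain ⟨D, hD, hdir, hCD⟩ : ∃ D : Set (ProbabilityMeasure A), MeasurableSet D ∧
      (∀ a, diracProba a ∈ D) ∧ ∀ π, C π ↔ ∀ n ip, π.prob n ip ∈ D := by
    rcases hC with rfl | rfl
    · exact ⟨Set.univ, MeasurableSet.univ, fun _ => trivial, fun _ => by simp⟩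
    · refine ⟨_, measurableSet_range_diracProba, Set.mem_range_self, fun π => ?_⟩
      exact forall₂_congr fun n ip => exists_congr fun a =>
        ⟨fun h => Subtype.ext h.symm, fun h => (congrArg ProbabilityMeasure.toMeasure h).symm⟩
  rcases isEmpty_or_nonempty (ProbabilityMeasure X) with hX | ⟨⟨p0⟩⟩
  · refine ⟨fun r => ?_, fun ε _ => ?_⟩
    · rw [Set.eq_empty_of_isEmpty {x | gOptI q F C J x ≤ (r : EReal)}]
      exact analyticSet_empty
    · let π : PolicyI X U :=
        { μ := fun _ ip => isEmptyElim ip.2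
          isProb := fun _ ip => isEmptyElim ip.2
          umeas := fun _ _ _ => (measurable_of_empty _).universallyMeasurable
          feasible := fun _ _ p0 => isEmptyElim p0 }
      exact ⟨π, isEmptyElim, (hCD π).2 fun _ ip => isEmptyElim ip.2, isEmptyElim, isEmptyElim,
        isEmptyElim⟩
  · have : Nonempty (ProbabilityMeasure X) := ⟨p0⟩
    have : Nonempty X := p0.nonempty
    have : Nonempty A := ⟨(hne 0 (Fin.elim0, F (Classical.arbitrary X))).some⟩
    exact lowerSemianalytic_gOptI_and_goodPolicyI hF hne hΓ hD hdir hCD hJ'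

end PaperStmt
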